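/- Suppose ρ₁ ≠ ρ₂ and c'' = c/(ρ₁⁻¹ − ρ₂⁻¹) ∈ ℚ ∖ E_a. Then μ_{M,D} is a spectral measure if and only if ρ₁⁻¹ is an integer divisible by p. -/

import Mathlib

open MeasureTheory Complex Matrix
open scoped ENNReal

noncomputable section

/-- The exponential function `e_λ(x) = e^{-2πi⟨λ,x⟩}` on `ℝ²`. -/
def expChar (lam x : Fin 2 → ℝ) : ℂ :=
  Complex.exp ((-2 * Real.pi * Complex.I) * ((lam 0 * x 0 + lam 1 * x 1 : ℝ) : ℂ))

/-- The Fourier transform `μ̂(ξ) = ∫ e^{-2πi⟨ξ,x⟩} dμ(x)` of a measure on `ℝ²`. -/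
def ftMeasure (μ : Measure (Fin 2 → ℝ)) (ξ : Fin 2 → ℝ) : ℂ :=
  ∫ x, expChar ξ x ∂μ

/-- The mask `m_D(ξ) = (1/p) Σ_{d∈D} e^{-2πi⟨ξ,d⟩}` of a digit system `D : Fin p → ℝ²`. -/
def mask {p : ℕ} (D : Fin p → (Fin 2 → ℝ)) (ξ : Fin 2 → ℝ) : ℂ :=
  (p : ℂ)⁻¹ * ∑ i : Fin p, expChar ξ (D i)

/-- Integer digits, coerced to real vectors. -/
def digitR {p : ℕ} (D : Fin p → (Fin 2 → ℤ)) : Fin p → (Fin 2 → ℝ) :=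
  fun i j => (D i j : ℝ)

/-- `μ` is the self-affine measure of the IFS `φ_d(x) = M⁻¹(x+d)`, `d ∈ D`:
a compactly supported Borel probability measure with `μ = (1/#D) Σ_d μ ∘ φ_d⁻¹`. -/
def IsSelfAffine {p : ℕ} (μ : Measure (Fin 2 → ℝ)) (M : Matrix (Fin 2) (Fin 2) ℝ)
    (D : Fin p → (Fin 2 → ℝ)) : Prop :=
  IsProbabilityMeasure μ ∧ (∃ K : Set (Fin 2 → ℝ), IsCompact K ∧ μ Kᶜ = 0) ∧
  μ = (p : ℝ≥0∞)⁻¹ • ∑ i : Fin p, μ.map (fun x => M⁻¹.mulVec (x + D i))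

/-- `Λ` is an orthogonal set of exponentials for `μ`. -/
def IsOrthoSet (μ : Measure (Fin 2 → ℝ)) (Λ : Set (Fin 2 → ℝ)) : Prop :=
  ∀ l ∈ Λ, ∀ l' ∈ Λ, l ≠ l' → ftMeasure μ (l - l') = 0

/-- `μ` is a spectral measure: some countable set of exponentials forms an
orthonormal (Hilbert) basis of `L²(μ)`. -/
def IsSpectral (μ : Measure (Fin 2 → ℝ)) : Prop :=
  ∃ Λ : Set (Fin 2 → ℝ), Λ.Countable ∧
    ∃ b : HilbertBasis Λ ℂ (Lp ℂ 2 μ),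
      ∀ lam : Λ, ⇑(b lam) =ᵐ[μ] expChar (lam : Fin 2 → ℝ)

/-- The standing assumption on the digit set: `a = (a₁,a₂)` has entries in `[1,p-1]`
and `Z(m_D) = ⋃_{j=1}^{p-1} (j·a/p + ℤ²)`. -/
def ZeroSetCond (p : ℕ) (D : Fin p → (Fin 2 → ℤ)) (a : Fin 2 → ℤ) : Prop :=
  (∀ i, 1 ≤ a i ∧ a i ≤ (p : ℤ) - 1) ∧
  ∀ ξ : Fin 2 → ℝ, mask (digitR D) ξ = 0 ↔
    ∃ j : ℕ, 1 ≤ j ∧ j ≤ p - 1 ∧ ∃ k : Fin 2 → ℤ,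
      ∀ i, ξ i = (j : ℝ) * (a i : ℝ) / p + (k i : ℝ)

/-- The upper-triangular expanding matrix `M = [[ρ₁⁻¹, c],[0, ρ₂⁻¹]]`. -/
def Mupper (ρ₁ ρ₂ c : ℝ) : Matrix (Fin 2) (Fin 2) ℝ := !![ρ₁⁻¹, c; 0, ρ₂⁻¹]

/-- The set `E_a = {h/l : gcd(h,l)=1, l·a₂ − h·a₁ ∈ ℤ∖pℤ} ∪ {0}`. -/
def Ea (p : ℕ) (a : Fin 2 → ℤ) : Set ℝ :=
  {x | ∃ h l : ℤ, Int.gcd h l = 1 ∧ ¬ ((p : ℤ) ∣ (l * a 1 - h * a 0)) ∧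
    x = (h : ℝ) / (l : ℝ)} ∪ {0}


lemma expChar_norm (l x : Fin 2 → ℝ) : ‖expChar l x‖ = 1 := by
  unfold expChar
  rw [show (-2 * (Real.pi:ℂ) * Complex.I) * ((l 0 * x 0 + l 1 * x 1 : ℝ) : ℂ)
    = ((-2 * Real.pi * (l 0 * x 0 + l 1 * x 1) : ℝ) : ℂ) * Complex.I by push_cast; ring]
  exact Complex.norm_exp_ofReal_mul_I _

lemma expChar_add_left (l l' x : Fin 2 → ℝ) :
    expChar (l + l') x = expChar l x * expChar l' x := by
  unfold expChar
  rw [← Complex.exp_add]; congr 1; simp; ring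

lemma expChar_add_right (l x y : Fin 2 → ℝ) :
    expChar l (x + y) = expChar l x * expChar l y := by
  unfold expChar
  rw [← Complex.exp_add]; congr 1; simp; ring

lemma expChar_neg (l x : Fin 2 → ℝ) :
    expChar (-l) x = (starRingEnd ℂ) (expChar l x) := by
  unfold expChar
  rw [← Complex.exp_conj]; congr 1
  have h2 : (starRingEnd ℂ) 2 = 2 := Complex.conj_ofReal 2
  simp [h2]; ring

lemma expChar_zero (x : Fin 2 → ℝ) : expChar 0 x = 1 := by simp [expChar]

lemma expChar_zero_right (x : Fin 2 → ℝ) : expChar x 0 = 1 := by simp [expChar]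

lemma expChar_sub (l l' x : Fin 2 → ℝ) :
    expChar (l - l') x = expChar l x * (starRingEnd ℂ) (expChar l' x) := by
  rw [sub_eq_add_neg, expChar_add_left, expChar_neg]

lemma expChar_cont (l : Fin 2 → ℝ) : Continuous (expChar l) := by
  unfold expChar; fun_prop

lemma expChar_cont_left (x : Fin 2 → ℝ) : Continuous (fun l => expChar l x) := by
  unfold expChar; fun_prop

lemma expChar_int (ν : Measure (Fin 2 → ℝ)) [IsFiniteMeasure ν] (l : Fin 2 → ℝ) :
    Integrable (expChar l) ν :=
  Integrable.of_bound (expChar_cont l).aestronglyMeasurable 1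
    (Filter.Eventually.of_forall fun x => (expChar_norm l x).le)

lemma expChar_memLp (ν : Measure (Fin 2 → ℝ)) [IsFiniteMeasure ν] (l : Fin 2 → ℝ) :
    MemLp (expChar l) 2 ν :=
  MemLp.of_bound (expChar_cont l).aestronglyMeasurable 1
    (Filter.Eventually.of_forall fun x => (expChar_norm l x).le)

/-- exponential as an element of L² -/
def eLp (ν : Measure (Fin 2 → ℝ)) [IsFiniteMeasure ν] (l : Fin 2 → ℝ) : Lp ℂ 2 ν :=
  (expChar_memLp ν l).toLp _

lemma inner_eLp (ν : Measure (Fin 2 → ℝ)) [IsFiniteMeasure ν] (l l' : Fin 2 → ℝ) :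
    inner ℂ (eLp ν l) (eLp ν l') = ftMeasure ν (l' - l) := by
  rw [L2.inner_def, ftMeasure]
  apply integral_congr_ae
  filter_upwards [(expChar_memLp ν l).coeFn_toLp, (expChar_memLp ν l').coeFn_toLp] with x h1 h2
  rw [eLp, eLp, h1, h2, expChar_sub]
  simp

lemma ft_zero (ν : Measure (Fin 2 → ℝ)) [IsProbabilityMeasure ν] : ftMeasure ν 0 = 1 := by
  simp [ftMeasure, expChar_zero]

lemma ft_norm_le (ν : Measure (Fin 2 → ℝ)) [IsProbabilityMeasure ν] (ξ : Fin 2 → ℝ) :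
    ‖ftMeasure ν ξ‖ ≤ 1 := by
  unfold ftMeasure
  calc _ ≤ ∫ x, ‖expChar ξ x‖ ∂ν := norm_integral_le_integral_norm _
    _ = 1 := by simp [expChar_norm]

lemma ft_cont (ν : Measure (Fin 2 → ℝ)) [IsProbabilityMeasure ν] : Continuous (ftMeasure ν) := by
  unfold ftMeasure
  apply continuous_of_dominated (bound := fun _ => 1)
  · intro l; exact (expChar_cont l).aestronglyMeasurable
  · intro l; exact Filter.Eventually.of_forall fun x => (expChar_norm l x).le
  · exact integrable_const _
  · exact Filter.Eventually.of_forall fun x => expChar_cont_left x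

lemma eLp_norm (ν : Measure (Fin 2 → ℝ)) [IsProbabilityMeasure ν] (l : Fin 2 → ℝ) :
    ‖eLp ν l‖ = 1 := by
  have h := inner_eLp ν l l
  rw [sub_self, ft_zero, inner_self_eq_norm_sq_to_K] at h
  have h2 : ‖eLp ν l‖ ^ 2 = 1 := by
    have := congrArg Complex.re h
    simpa [← Complex.ofReal_pow] using this
  nlinarith [norm_nonneg (eLp ν l)]

lemma eLp_orthonormal (ν : Measure (Fin 2 → ℝ)) [IsProbabilityMeasure ν] (S : Set (Fin 2 → ℝ))
    (h : IsOrthoSet ν S) : Orthonormal ℂ (fun l : S => eLp ν (l : Fin 2 → ℝ)) := by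
  refine ⟨fun l => eLp_norm ν _, ?_⟩
  intro l l' hne
  show inner ℂ (eLp ν l) (eLp ν l') = 0
  rw [inner_eLp]
  exact h _ l'.2 _ l.2 (fun h => hne (Subtype.ext h.symm))

/-- Bessel's inequality -/
lemma bessel (ν : Measure (Fin 2 → ℝ)) [IsProbabilityMeasure ν] (S : Set (Fin 2 → ℝ))
    (h : IsOrthoSet ν S) (ξ : Fin 2 → ℝ) (s : Finset (Fin 2 → ℝ)) (hs : (s : Set _) ⊆ S) :
    ∑ l ∈ s, ‖ftMeasure ν (ξ - l)‖ ^ 2 ≤ 1 := by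
  have h2 : IsOrthoSet ν (s : Set _) := fun l hl l' hl' => h l (hs hl) l' (hs hl')
  have := (eLp_orthonormal ν _ h2).sum_inner_products_le (eLp ν ξ) (s := Finset.univ)
  simp only [inner_eLp, eLp_norm] at this
  rw [one_pow] at this
  rw [← Finset.sum_coe_sort s]
  exact this

/-- The transposed inverse matrix acting on frequencies. -/
def Rmap (ρ₁ ρ₂ c : ℝ) (ξ : Fin 2 → ℝ) : Fin 2 → ℝ :=
  ![ρ₁ * ξ 0, ρ₂ * (ξ 1 - c * ρ₁ * ξ 0)]

lemma Rmap_zero_coord (ρ₁ ρ₂ c : ℝ) (ξ : Fin 2 → ℝ) : Rmap ρ₁ ρ₂ c ξ 0 = ρ₁ * ξ 0 := by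
  simp [Rmap]

lemma Rmap_iter_zero_coord (ρ₁ ρ₂ c : ℝ) (n : ℕ) (ξ : Fin 2 → ℝ) :
    (Rmap ρ₁ ρ₂ c)^[n] ξ 0 = ρ₁ ^ n * ξ 0 := by
  induction n with
  | zero => simp
  | succ n ih => rw [Function.iterate_succ_apply', Rmap_zero_coord, ih]; ring

lemma Rmap_add (ρ₁ ρ₂ c : ℝ) (x y : Fin 2 → ℝ) :
    Rmap ρ₁ ρ₂ c (x + y) = Rmap ρ₁ ρ₂ c x + Rmap ρ₁ ρ₂ c y := by
  ext i; fin_cases i <;> simp [Rmap] <;> ring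

lemma Rmap_sub (ρ₁ ρ₂ c : ℝ) (x y : Fin 2 → ℝ) :
    Rmap ρ₁ ρ₂ c (x - y) = Rmap ρ₁ ρ₂ c x - Rmap ρ₁ ρ₂ c y := by
  ext i; fin_cases i <;> simp [Rmap] <;> ring

lemma Rmap_smul (ρ₁ ρ₂ c t : ℝ) (x : Fin 2 → ℝ) :
    Rmap ρ₁ ρ₂ c (t • x) = t • Rmap ρ₁ ρ₂ c x := by
  ext i; fin_cases i <;> simp [Rmap] <;> ring

lemma Rmap_iter_add (ρ₁ ρ₂ c : ℝ) (n : ℕ) (x y : Fin 2 → ℝ) :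
    (Rmap ρ₁ ρ₂ c)^[n] (x + y) = (Rmap ρ₁ ρ₂ c)^[n] x + (Rmap ρ₁ ρ₂ c)^[n] y := by
  induction n with
  | zero => simp
  | succ n ih => simp only [Function.iterate_succ_apply', ih, Rmap_add]

lemma Rmap_iter_sub (ρ₁ ρ₂ c : ℝ) (n : ℕ) (x y : Fin 2 → ℝ) :
    (Rmap ρ₁ ρ₂ c)^[n] (x - y) = (Rmap ρ₁ ρ₂ c)^[n] x - (Rmap ρ₁ ρ₂ c)^[n] y := by
  induction n with
  | zero => simp
  | succ n ih => simp only [Function.iterate_succ_apply', ih, Rmap_sub]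

lemma Rmap_iter_smul (ρ₁ ρ₂ c t : ℝ) (n : ℕ) (x : Fin 2 → ℝ) :
    (Rmap ρ₁ ρ₂ c)^[n] (t • x) = t • (Rmap ρ₁ ρ₂ c)^[n] x := by
  induction n with
  | zero => simp
  | succ n ih => simp only [Function.iterate_succ_apply', ih, Rmap_smul]

/-- If `ρ₁ ≠ ρ₂` then the iterates are explicit. -/
lemma Rmap_iter_one_coord (ρ₁ ρ₂ c : ℝ) (h1 : ρ₁ ≠ 0) (h2 : ρ₂ ≠ 0) (h : ρ₁ ≠ ρ₂) (n : ℕ)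
    (ξ : Fin 2 → ℝ) :
    (Rmap ρ₁ ρ₂ c)^[n] ξ 1 = ρ₂ ^ n * (ξ 1 - c / (ρ₁⁻¹ - ρ₂⁻¹) * ξ 0)
      + ρ₁ ^ n * (c / (ρ₁⁻¹ - ρ₂⁻¹) * ξ 0) := by
  have h3 : ρ₂ - ρ₁ ≠ 0 := sub_ne_zero.mpr (Ne.symm h)
  have h4 : c / (ρ₁⁻¹ - ρ₂⁻¹) = c * ρ₁ * ρ₂ / (ρ₂ - ρ₁) := by
    rw [inv_sub_inv h1 h2]; field_simp
  rw [h4]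
  induction n with
  | zero => simp
  | succ n ih =>
    rw [Function.iterate_succ_apply', Rmap]
    simp only [Matrix.cons_val_one, Matrix.cons_val_fin_one]
    rw [ih, Rmap_iter_zero_coord]
    field_simp
    ring

lemma Rmap_iter_tendsto (ρ₁ ρ₂ c : ℝ) (h10 : 0 < ρ₁) (h11 : ρ₁ < 1) (h20 : 0 < ρ₂) (h21 : ρ₂ < 1)
    (h : ρ₁ ≠ ρ₂) (ξ : Fin 2 → ℝ) :
    Filter.Tendsto (fun n => (Rmap ρ₁ ρ₂ c)^[n] ξ) Filter.atTop (nhds 0) := by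
  have t1 := tendsto_pow_atTop_nhds_zero_of_lt_one h10.le h11
  have t2 := tendsto_pow_atTop_nhds_zero_of_lt_one h20.le h21
  rw [tendsto_pi_nhds]
  intro i
  fin_cases i
  · simp only [Fin.zero_eta, Rmap_iter_zero_coord]
    simpa using t1.mul_const (ξ 0)
  · simp only [Fin.mk_one, Rmap_iter_one_coord ρ₁ ρ₂ c h10.ne' h20.ne' h]
    simpa using (t2.mul_const _).add (t1.mul_const _)

lemma Mupper_inv (ρ₁ ρ₂ c : ℝ) (h1 : ρ₁ ≠ 0) (h2 : ρ₂ ≠ 0) :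
    (Mupper ρ₁ ρ₂ c)⁻¹ = !![ρ₁, -c * ρ₁ * ρ₂; 0, ρ₂] := by
  apply Matrix.inv_eq_right_inv
  unfold Mupper
  ext i j
  fin_cases i <;> fin_cases j <;> simp [h1, h2, Matrix.mul_apply, Fin.sum_univ_two]
  field_simp
  ring

lemma expChar_Minv (ρ₁ ρ₂ c : ℝ) (h1 : ρ₁ ≠ 0) (h2 : ρ₂ ≠ 0) (ξ x : Fin 2 → ℝ) :
    expChar ξ ((Mupper ρ₁ ρ₂ c)⁻¹.mulVec x) = expChar (Rmap ρ₁ ρ₂ c ξ) x := by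
  rw [Mupper_inv _ _ _ h1 h2]
  unfold expChar Rmap
  congr 2
  simp [Matrix.mulVec, dotProduct, Fin.sum_univ_two]
  ring

/-- The Hutchinson operator. -/
def HutOp {p : ℕ} (M : Matrix (Fin 2) (Fin 2) ℝ) (D : Fin p → (Fin 2 → ℝ))
    (ν : Measure (Fin 2 → ℝ)) : Measure (Fin 2 → ℝ) :=
  (p : ℝ≥0∞)⁻¹ • ∑ i : Fin p, ν.map (fun x => M⁻¹.mulVec (x + D i))

lemma phi_cont (M : Matrix (Fin 2) (Fin 2) ℝ) (d : Fin 2 → ℝ) :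
    Continuous (fun x : Fin 2 → ℝ => M.mulVec (x + d)) := by
  fun_prop

lemma HutOp_prob {p : ℕ} (hp : p ≠ 0) (M : Matrix (Fin 2) (Fin 2) ℝ) (D : Fin p → (Fin 2 → ℝ))
    (ν : Measure (Fin 2 → ℝ)) [IsProbabilityMeasure ν] : IsProbabilityMeasure (HutOp M D ν) := by
  constructor
  unfold HutOp
  have : ∀ i, (ν.map (fun x => M⁻¹.mulVec (x + D i))) Set.univ = 1 := fun i => by
    rw [Measure.map_apply (phi_cont _ _).measurable MeasurableSet.univ]; simp
  simp only [Measure.smul_apply, Measure.finsetSum_apply, this, smul_eq_mul]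
  simp
  exact ENNReal.inv_mul_cancel (by exact_mod_cast hp) (by simp)

lemma ft_HutOp {p : ℕ} (ρ₁ ρ₂ c : ℝ) (h1 : ρ₁ ≠ 0) (h2 : ρ₂ ≠ 0) (D : Fin p → (Fin 2 → ℝ))
    (ν : Measure (Fin 2 → ℝ)) [IsProbabilityMeasure ν] (ξ : Fin 2 → ℝ) :
    ftMeasure (HutOp (Mupper ρ₁ ρ₂ c) D ν) ξ
      = mask D (Rmap ρ₁ ρ₂ c ξ) * ftMeasure ν (Rmap ρ₁ ρ₂ c ξ) := by
  unfold HutOp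
  rw [ftMeasure, integral_smul_measure, integral_finsetSum_measure]
  · have : ∀ i, ∫ x, expChar ξ x ∂(ν.map (fun x => (Mupper ρ₁ ρ₂ c)⁻¹.mulVec (x + D i)))
        = expChar (Rmap ρ₁ ρ₂ c ξ) (D i) * ftMeasure ν (Rmap ρ₁ ρ₂ c ξ) := by
      intro i
      rw [integral_map (phi_cont _ _).measurable.aemeasurable
        (expChar_cont ξ).aestronglyMeasurable]
      simp only [expChar_Minv _ _ _ h1 h2, expChar_add_right]
      rw [integral_mul_const, mul_comm]; rfl
    simp only [this]
    rw [← Finset.sum_mul, mask]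
    simp [mul_assoc]
  · intro i _
    have : IsProbabilityMeasure (ν.map (fun x => (Mupper ρ₁ ρ₂ c)⁻¹.mulVec (x + D i))) :=
      Measure.isProbabilityMeasure_map (phi_cont _ _).measurable.aemeasurable
    exact expChar_int _ _

/-- Partial products. -/
def Pp (m : (Fin 2 → ℝ) → ℂ) (R : (Fin 2 → ℝ) → (Fin 2 → ℝ)) (n : ℕ) (ξ : Fin 2 → ℝ) : ℂ :=
  ∏ i ∈ Finset.range n, m (R^[i + 1] ξ)

lemma Pp_succ' (m : (Fin 2 → ℝ) → ℂ) (R : (Fin 2 → ℝ) → (Fin 2 → ℝ)) (n : ℕ) (ξ : Fin 2 → ℝ) :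
    Pp m R (n + 1) ξ = m (R ξ) * Pp m R n (R ξ) := by
  unfold Pp
  rw [Finset.prod_range_succ', mul_comm]
  rfl

lemma exists_partial {p : ℕ} (hp : p ≠ 0) (ρ₁ ρ₂ c : ℝ) (h1 : ρ₁ ≠ 0) (h2 : ρ₂ ≠ 0)
    (D : Fin p → (Fin 2 → ℝ)) (ν : Measure (Fin 2 → ℝ)) [IsProbabilityMeasure ν] (n : ℕ) :
    ∃ ν' : Measure (Fin 2 → ℝ), IsProbabilityMeasure ν' ∧ ∀ ξ, ftMeasure ν' ξ
      = Pp (mask D) (Rmap ρ₁ ρ₂ c) n ξ * ftMeasure ν ((Rmap ρ₁ ρ₂ c)^[n] ξ) := by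
  induction n with
  | zero => exact ⟨ν, inferInstance, fun ξ => by simp [Pp]⟩
  | succ n ih =>
    obtain ⟨ν', hν', h⟩ := ih
    refine ⟨HutOp (Mupper ρ₁ ρ₂ c) D ν', HutOp_prob hp _ _ _, fun ξ => ?_⟩
    rw [ft_HutOp _ _ _ h1 h2, h, Pp_succ', Function.iterate_succ_apply, mul_assoc]

lemma ft_dirac (ξ : Fin 2 → ℝ) : ftMeasure (Measure.dirac 0) ξ = 1 := by
  rw [ftMeasure, integral_dirac]
  simp [expChar]

lemma ft_map {ρ₁ ρ₂ : ℝ} (c : ℝ) (h1 : ρ₁ ≠ 0) (h2 : ρ₂ ≠ 0) (ν : Measure (Fin 2 → ℝ)) (ξ : Fin 2 → ℝ) :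
    ftMeasure (ν.map (fun x => (Mupper ρ₁ ρ₂ c)⁻¹.mulVec (x + 0))) ξ
      = ftMeasure ν (Rmap ρ₁ ρ₂ c ξ) := by
  rw [ftMeasure, integral_map (phi_cont _ _).measurable.aemeasurable
        (expChar_cont ξ).aestronglyMeasurable]
  simp only [expChar_Minv _ _ _ h1 h2, add_zero]
  rfl

lemma mask_norm_le {p : ℕ} (hp : p ≠ 0) (D : Fin p → (Fin 2 → ℝ)) (ξ : Fin 2 → ℝ) :
    ‖mask D ξ‖ ≤ 1 := by
  unfold mask
  rw [norm_mul]
  calc _ ≤ ‖(p:ℂ)⁻¹‖ * ∑ i : Fin p, ‖expChar ξ (D i)‖ := by gcongr; exact norm_sum_le _ _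
    _ = 1 := by simp [expChar_norm, hp]

lemma real_ae_zero (μ : Measure (Fin 2 → ℝ)) [IsFiniteMeasure μ] (g : (Fin 2 → ℝ) → ℝ)
    (hg : Integrable g μ) (h : ∀ ξ, ∫ x, (g x : ℂ) * expChar ξ x ∂μ = 0) : g =ᵐ[μ] 0 := by
  have hgm : AEMeasurable g μ := hg.aemeasurable
  have i1 : IsFiniteMeasure (μ.withDensity (fun x => ENNReal.ofReal (g x))) :=
    isFiniteMeasure_withDensity_ofReal hg.2
  have i2 : IsFiniteMeasure (μ.withDensity (fun x => ENNReal.ofReal (-g x))) :=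
    isFiniteMeasure_withDensity_ofReal hg.neg.2
  have key : μ.withDensity (fun x => ENNReal.ofReal (g x))
      = μ.withDensity (fun x => ENNReal.ofReal (-g x)) := by
    apply Measure.ext_of_charFunDual
    ext L
    rw [charFunDual_apply, charFunDual_apply]
    have hL : ∀ v : Fin 2 → ℝ, Complex.exp (L v * I)
        = expChar (fun i => - L (Pi.single i 1) / (2 * Real.pi)) v := by
      intro v
      unfold expChar
      congr 1
      have : L v = v 0 * L (Pi.single 0 1) + v 1 * L (Pi.single 1 1) := by
        conv_lhs => rw [show v = v 0 • Pi.single 0 1 + v 1 • Pi.single 1 1 by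
          ext i; fin_cases i <;> simp]
        rw [map_add, map_smul, map_smul]; simp
      rw [this]
      have hpi : (Real.pi : ℂ) ≠ 0 := by exact_mod_cast Real.pi_ne_zero
      push_cast
      field_simp
      ring
    simp only [hL]
    set ξ : Fin 2 → ℝ := (fun i => - L (Pi.single i 1) / (2 * Real.pi))
    rw [integral_withDensity_eq_integral_toReal_smul₀ (by fun_prop) (by simp),
      integral_withDensity_eq_integral_toReal_smul₀ (by fun_prop) (by simp), ← sub_eq_zero,
      ← integral_sub]
    · rw [← h ξ]
      congr 1
      ext x
      simp only [Complex.real_smul]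
      rw [← sub_mul, ← Complex.ofReal_sub]
      congr 2
      rcases le_total 0 (g x) with h | h <;> simp [ENNReal.toReal_ofReal', h]
    · simp only [Complex.real_smul, ENNReal.toReal_ofReal']
      exact (hg.pos_part.ofReal (𝕜 := ℂ)).mul_bdd (c := 1) (expChar_cont ξ).aestronglyMeasurable
        (Filter.Eventually.of_forall fun x => (expChar_norm ξ x).le)
    · simp only [Complex.real_smul, ENNReal.toReal_ofReal']
      exact (hg.neg_part.ofReal (𝕜 := ℂ)).mul_bdd (c := 1) (expChar_cont ξ).aestronglyMeasurable
        (Filter.Eventually.of_forall fun x => (expChar_norm ξ x).le)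
  rw [withDensity_eq_iff_of_sigmaFinite (by fun_prop) (by fun_prop)] at key
  filter_upwards [key] with x hx
  have := congrArg ENNReal.toReal hx
  simp only [ENNReal.toReal_ofReal'] at this
  rcases le_total 0 (g x) with h | h <;> simp [h] at this ⊢ <;> linarith

lemma complex_ae_zero (μ : Measure (Fin 2 → ℝ)) [IsFiniteMeasure μ] (f : (Fin 2 → ℝ) → ℂ)
    (hf : Integrable f μ) (h : ∀ ξ, ∫ x, f x * expChar ξ x ∂μ = 0) : f =ᵐ[μ] 0 := by
  have hi : ∀ ξ, Integrable (fun x => f x * expChar ξ x) μ := fun ξ =>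
    hf.mul_bdd (c := 1) (expChar_cont ξ).aestronglyMeasurable
      (Filter.Eventually.of_forall fun x => (expChar_norm ξ x).le)
  have hc : ∀ ξ, ∫ x, (starRingEnd ℂ) (f x) * expChar ξ x ∂μ = 0 := by
    intro ξ
    have := integral_conj (μ := μ) (f := fun x => f x * expChar (-ξ) x)
    rw [h (-ξ)] at this
    simpa [expChar_neg] using this
  have hic : ∀ ξ, Integrable (fun x => (starRingEnd ℂ) (f x) * expChar ξ x) μ := fun ξ =>
    Integrable.mul_bdd (c := 1) ((LinearIsometryEquiv.integrable_comp_iff Complex.conjLIE).mpr hf)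
      (expChar_cont ξ).aestronglyMeasurable
      (Filter.Eventually.of_forall fun x => (expChar_norm ξ x).le)
  have h1 := real_ae_zero μ (fun x => (f x).re) hf.re (by
    intro ξ
    have : ∀ x, ((f x).re : ℂ) * expChar ξ x
        = (1/2) * (f x * expChar ξ x + (starRingEnd ℂ) (f x) * expChar ξ x) := by
      intro x; rw [Complex.re_eq_add_conj]; ring
    simp only [this]
    rw [integral_const_mul, integral_add (hi ξ) (hic ξ), h, hc]; simp)
  have h2 := real_ae_zero μ (fun x => (f x).im) hf.im (by
    intro ξ
    have : ∀ x, ((f x).im : ℂ) * expChar ξ x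
        = (1/(2*I)) * (f x * expChar ξ x - (starRingEnd ℂ) (f x) * expChar ξ x) := by
      intro x; rw [Complex.im_eq_sub_conj]; ring
    simp only [this]
    rw [integral_const_mul, integral_sub (hi ξ) (hic ξ), h, hc]; simp)
  filter_upwards [h1, h2] with x h1 h2
  exact Complex.ext h1 h2

lemma eLp_total (μ : Measure (Fin 2 → ℝ)) [IsProbabilityMeasure μ] (f : Lp ℂ 2 μ)
    (h : ∀ ξ, inner ℂ (eLp μ ξ) f = 0) : f = 0 := by
  rw [Lp.eq_zero_iff_ae_eq_zero]
  apply complex_ae_zero μ f ((Lp.memLp f).integrable (by norm_num))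
  intro ξ
  rw [← h (-ξ), L2.inner_def]
  apply integral_congr_ae
  filter_upwards [(expChar_memLp μ (-ξ)).coeFn_toLp] with x h1
  rw [eLp, h1, expChar_neg]
  simp

lemma spectral_of_sum (μ : Measure (Fin 2 → ℝ)) [IsProbabilityMeasure μ] (S : Set (Fin 2 → ℝ))
    (hS : S.Countable) (ho : IsOrthoSet μ S)
    (hsum : ∀ ξ, HasSum (fun l : S => ‖ftMeasure μ (ξ - l)‖ ^ 2) 1) : IsSpectral μ := by
  have hv := eLp_orthonormal μ S ho
  have hsp : (Submodule.span ℂ (Set.range (fun l : S => eLp μ (l : Fin 2 → ℝ))))ᗮ = ⊥ := by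
    rw [Submodule.eq_bot_iff]
    intro f hf
    apply eLp_total
    intro ξ
    have hf' : ∀ l : S, inner ℂ (eLp μ (l : Fin 2 → ℝ)) f = 0 := fun l =>
      (Submodule.mem_orthogonal _ _).mp hf _ (Submodule.subset_span ⟨l, rfl⟩)
    -- norm of remainder
    have hrem : ∀ s : Finset S, ‖inner ℂ (eLp μ ξ) f‖ ^ 2
        ≤ (1 - ∑ l ∈ s, ‖ftMeasure μ (ξ - l)‖ ^ 2) * ‖f‖ ^ 2 := by
      intro s
      set w := eLp μ ξ - ∑ l ∈ s, (inner ℂ (eLp μ (l : Fin 2 → ℝ)) (eLp μ ξ)) • eLp μ (l : Fin 2 → ℝ)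
        with hw
      have e1 : inner ℂ (eLp μ ξ) f = inner ℂ w f := by
        rw [hw, inner_sub_left, sum_inner]
        simp [inner_smul_left, hf']
      have e2 : ‖w‖ ^ 2 = 1 - ∑ l ∈ s, ‖ftMeasure μ (ξ - l)‖ ^ 2 := by
        have e3 : (inner ℂ w w : ℂ) = 1 - ∑ l ∈ s, (‖ftMeasure μ (ξ - l)‖ ^ 2 : ℂ) := by
          have e4 : ∀ l ∈ s, inner ℂ w (eLp μ (l : Fin 2 → ℝ)) = 0 := by
            intro l hl
            rw [hw, inner_sub_left, hv.inner_left_sum _ hl]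
            simp
          have e6 : (inner ℂ w w : ℂ) = inner ℂ (eLp μ ξ) w - ∑ l ∈ s, inner ℂ ((inner ℂ (eLp μ (l : Fin 2 → ℝ)) (eLp μ ξ)) • eLp μ (l : Fin 2 → ℝ)) w := by
            rw [← sum_inner, ← inner_sub_left]
          have e5 : ∀ l ∈ s, inner ℂ ((inner ℂ (eLp μ (l : Fin 2 → ℝ)) (eLp μ ξ)) •
              eLp μ (l : Fin 2 → ℝ)) w = 0 := by
            intro l hl
            rw [inner_smul_left, ← inner_conj_symm _ w, e4 l hl]; simp
          rw [e6, Finset.sum_eq_zero e5, sub_zero, hw, inner_sub_right, inner_sum,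
            inner_eLp, sub_self, ft_zero]
          congr 1
          apply Finset.sum_congr rfl
          intro l _
          rw [inner_smul_right, ← inner_conj_symm (eLp μ ξ), inner_eLp, Complex.mul_conj']
        rw [inner_self_eq_norm_sq_to_K] at e3
        have := congrArg Complex.re e3
        simpa [← Complex.ofReal_pow, ← Complex.ofReal_sum] using this
      rw [e1, ← e2, ← mul_pow]
      gcongr
      exact norm_inner_le_norm _ _
    have hlim := ((tendsto_const_nhds (x := (1:ℝ))).sub (hsum ξ)).mul_const (‖f‖ ^ 2)
    have := ge_of_tendsto' hlim hrem
    rw [sub_self, zero_mul] at this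
    have h0 : ‖inner ℂ (eLp μ ξ) f‖ = 0 := by
      nlinarith [norm_nonneg (inner ℂ (eLp μ ξ) f)]
    exact norm_eq_zero.mp h0
  refine ⟨S, hS, HilbertBasis.mkOfOrthogonalEqBot hv hsp, ?_⟩
  intro l
  rw [HilbertBasis.coe_mkOfOrthogonalEqBot]
  exact (expChar_memLp μ l).coeFn_toLp

lemma sum_of_spectral (μ : Measure (Fin 2 → ℝ)) [IsProbabilityMeasure μ] (h : IsSpectral μ) :
    ∃ S : Set (Fin 2 → ℝ), S.Countable ∧ IsOrthoSet μ S ∧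
      ∀ ξ, HasSum (fun l : S => ‖ftMeasure μ (ξ - l)‖ ^ 2) 1 := by
  obtain ⟨S, hS, b, hb⟩ := h
  have hb' : ∀ l : S, b l = eLp μ (l : Fin 2 → ℝ) := by
    intro l
    apply Lp.ext
    exact (hb l).trans (expChar_memLp μ l).coeFn_toLp.symm
  refine ⟨S, hS, ?_, ?_⟩
  · intro l hl l' hl' hne
    have := b.orthonormal.2 (i := ⟨l', hl'⟩) (j := ⟨l, hl⟩) (fun h => hne (by simpa using h.symm))
    simp only [hb', inner_eLp] at this
    exact this
  · intro ξ
    have := b.hasSum_inner_mul_inner (eLp μ ξ) (eLp μ ξ)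
    rw [inner_eLp, sub_self, ft_zero] at this
    have h2 := Complex.hasSum_re this
    simp only [Complex.one_re] at h2
    convert h2 using 2 with l
    rw [hb', ← inner_conj_symm (eLp μ ξ), inner_eLp, mul_comm, Complex.mul_conj']
    norm_cast

lemma ft_selfaffine {p : ℕ} (ρ₁ ρ₂ c : ℝ) (h1 : ρ₁ ≠ 0) (h2 : ρ₂ ≠ 0) (D : Fin p → (Fin 2 → ℝ))
    (μ : Measure (Fin 2 → ℝ)) (hμ : IsSelfAffine μ (Mupper ρ₁ ρ₂ c) D) (ξ : Fin 2 → ℝ) :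
    ftMeasure μ ξ = mask D (Rmap ρ₁ ρ₂ c ξ) * ftMeasure μ (Rmap ρ₁ ρ₂ c ξ) := by
  have := hμ.1
  rw [← ft_HutOp ρ₁ ρ₂ c h1 h2 D μ ξ]
  congr 1
  exact hμ.2.2

lemma ft_iter (F m : (Fin 2 → ℝ) → ℂ) (R : (Fin 2 → ℝ) → (Fin 2 → ℝ))
    (hF : ∀ ξ, F ξ = m (R ξ) * F (R ξ)) (n : ℕ) (ξ : Fin 2 → ℝ) :
    F ξ = Pp m R n ξ * F (R^[n] ξ) := by
  induction n with
  | zero => simp [Pp]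
  | succ n ih =>
    rw [Pp, Finset.prod_range_succ, mul_assoc, Function.iterate_succ_apply', ← hF]
    exact ih

lemma Pp_eq_zero (m : (Fin 2 → ℝ) → ℂ) (R : (Fin 2 → ℝ) → (Fin 2 → ℝ)) (n k : ℕ) (hk : k < n)
    (ξ : Fin 2 → ℝ) (h : m (R^[k + 1] ξ) = 0) : Pp m R n ξ = 0 :=
  Finset.prod_eq_zero (Finset.mem_range.mpr hk) h

lemma ft_zero_of_mask (F m : (Fin 2 → ℝ) → ℂ) (R : (Fin 2 → ℝ) → (Fin 2 → ℝ))
    (hF : ∀ ξ, F ξ = m (R ξ) * F (R ξ)) (n : ℕ) (ξ : Fin 2 → ℝ) (h : m (R^[n + 1] ξ) = 0) :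
    F ξ = 0 := by
  rw [ft_iter F m R hF (n + 1), Pp_eq_zero m R (n+1) n (by omega) ξ h, zero_mul]

lemma mask_of_ft_zero (F m : (Fin 2 → ℝ) → ℂ) (R : (Fin 2 → ℝ) → (Fin 2 → ℝ))
    (hF : ∀ ξ, F ξ = m (R ξ) * F (R ξ)) (hc : Continuous F) (h0 : F 0 = 1)
    (hR : ∀ ξ, Filter.Tendsto (fun n => R^[n] ξ) Filter.atTop (nhds 0)) (ξ : Fin 2 → ℝ)
    (h : F ξ = 0) : ∃ n, m (R^[n + 1] ξ) = 0 := by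
  have t : Filter.Tendsto (fun n => F (R^[n] ξ)) Filter.atTop (nhds 1) := by
    rw [← h0]; exact (hc.tendsto 0).comp (hR ξ)
  obtain ⟨n, hn⟩ := (t.eventually_ne one_ne_zero).exists
  rw [ft_iter F m R hF n] at h
  rcases mul_eq_zero.mp h with h | h
  · obtain ⟨i, _, hi⟩ := Finset.prod_eq_zero_iff.mp h
    exact ⟨i, hi⟩
  · exact absurd h hn

lemma bessel_summable (ν : Measure (Fin 2 → ℝ)) [IsProbabilityMeasure ν] (S : Set (Fin 2 → ℝ))
    (h : IsOrthoSet ν S) (ξ : Fin 2 → ℝ) :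
    Summable (fun l : S => ‖ftMeasure ν (ξ - l)‖ ^ 2) ∧
      ∑' l : S, ‖ftMeasure ν (ξ - l)‖ ^ 2 ≤ 1 := by
  have key : ∀ s : Finset S, ∑ l ∈ s, ‖ftMeasure ν (ξ - l)‖ ^ 2 ≤ 1 := by
    intro s
    have := bessel ν S h ξ (s.map (Function.Embedding.subtype _)) (by intro x; simp; tauto)
    simpa using this
  exact ⟨summable_of_sum_le (fun _ => by positivity) key, Real.tsum_le_of_sum_le (fun _ => by positivity) key⟩

lemma mask_periodic {p : ℕ} (D : Fin p → (Fin 2 → ℤ)) (ξ k : Fin 2 → ℝ) (hk : ∀ i, ∃ z : ℤ, k i = z) :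
    mask (digitR D) (ξ + k) = mask (digitR D) ξ := by
  unfold mask
  congr 1
  apply Finset.sum_congr rfl
  intro i _
  rw [expChar_add_left]
  convert mul_one _
  obtain ⟨z0, h0⟩ := hk 0
  obtain ⟨z1, h1⟩ := hk 1
  unfold expChar digitR
  rw [Complex.exp_eq_one_iff]
  refine ⟨-(z0 * D i 0 + z1 * D i 1), ?_⟩
  rw [h0, h1]; push_cast; ring

lemma mask_at_zero {p : ℕ} (hp : p ≠ 0) (D : Fin p → (Fin 2 → ℝ)) : mask D 0 = 1 := by
  simp [mask, expChar_zero, hp]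

/-- Parseval for a compatible pair. -/
lemma mask_sum {p : ℕ} (hp : p ≠ 0) (D : Fin p → (Fin 2 → ℝ)) (w : Fin 2 → ℝ)
    (hw : ∀ j j' : Fin p, j ≠ j' → mask D (((j : ℝ) - (j' : ℝ)) • w) = 0) (ζ : Fin 2 → ℝ) :
    ∑ j : Fin p, ‖mask D (ζ + (j : ℝ) • w)‖ ^ 2 = 1 := by
  have hpc : (p : ℂ) ≠ 0 := by exact_mod_cast hp
  let H : Matrix (Fin p) (Fin p) ℂ := fun j i => expChar ((j : ℝ) • w) (D i)
  have hH : H * ((p : ℂ)⁻¹ • Hᴴ) = 1 := by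
    ext j j'
    rw [Matrix.mul_smul, Matrix.smul_apply, Matrix.mul_apply]
    have : ∑ i, H j i * Hᴴ i j' = ∑ i, expChar (((j : ℝ) - (j' : ℝ)) • w) (D i) := by
      apply Finset.sum_congr rfl
      intro i _
      rw [Matrix.conjTranspose_apply, sub_smul, expChar_sub]; rfl
    rw [this]
    have h2 : (p : ℂ)⁻¹ • ∑ i, expChar (((j : ℝ) - (j' : ℝ)) • w) (D i)
      = mask D (((j : ℝ) - (j' : ℝ)) • w) := rfl
    rw [h2]
    by_cases hj : j = j'
    · subst hj; simp [mask_at_zero hp]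
    · rw [hw j j' hj, Matrix.one_apply_ne hj]
  have hH2 : Hᴴ * H = (p : ℂ) • 1 := by
    have := mul_eq_one_comm.mp hH
    rw [Matrix.smul_mul] at this
    rw [← this, smul_smul, mul_inv_cancel₀ hpc, one_smul]
  let cv : Fin p → ℂ := fun i => expChar ζ (D i)
  have hm : ∀ j : Fin p, mask D (ζ + (j : ℝ) • w) = (p : ℂ)⁻¹ * (H *ᵥ cv) j := by
    intro j
    unfold mask
    congr 1
    apply Finset.sum_congr rfl
    intro i _
    rw [expChar_add_left, mul_comm]
  have e : star (H *ᵥ cv) ⬝ᵥ (H *ᵥ cv) = p * p := by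
    rw [Matrix.star_mulVec, ← Matrix.dotProduct_mulVec, Matrix.mulVec_mulVec, hH2,
      Matrix.smul_mulVec, Matrix.one_mulVec, dotProduct_smul]
    have : star cv ⬝ᵥ cv = p := by
      simp only [dotProduct, Pi.star_apply]
      have : ∀ i, star (cv i) * cv i = 1 := by
        intro i
        have := Complex.conj_mul' (cv i)
        rw [expChar_norm] at this
        simpa using this
      simp only [this]; simp
    rw [this]; rfl
  have e2 : ∑ j, ‖(H *ᵥ cv) j‖ ^ 2 = (p : ℝ) * p := by
    have h3 : ∀ j, star ((H *ᵥ cv) j) * (H *ᵥ cv) j = ((‖(H *ᵥ cv) j‖ ^ 2 : ℝ) : ℂ) := by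
      intro j
      have := Complex.conj_mul' ((H *ᵥ cv) j)
      push_cast
      exact this
    simp only [dotProduct, Pi.star_apply, h3] at e
    exact_mod_cast e
  simp only [hm, norm_mul, mul_pow]
  rw [← Finset.mul_sum, e2]
  have : (p : ℝ) ≠ 0 := by exact_mod_cast hp
  simp; field_simp

/-- Integers with an `n`-digit expansion in base `-N` -/
def XN (N : ℤ) (p : ℕ) : ℕ → Finset ℤ
  | 0 => {0}
  | n + 1 => ((Finset.univ : Finset (Fin p)) ×ˢ XN N p n).image (fun q => (q.1 : ℤ) - N * q.2)

lemma XN_mem_succ (N : ℤ) (p n : ℕ) (x : ℤ) :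
    x ∈ XN N p (n + 1) ↔ ∃ j : Fin p, ∃ y ∈ XN N p n, x = (j : ℤ) - N * y := by
  simp only [XN, Finset.mem_image, Finset.mem_product, Finset.mem_univ, true_and, Prod.exists]
  constructor
  · rintro ⟨j, y, hy, rfl⟩; exact ⟨j, y, hy, rfl⟩
  · rintro ⟨j, y, hy, rfl⟩; exact ⟨j, y, hy, rfl⟩

lemma XN_mono (N : ℤ) (p : ℕ) (hp : 0 < p) (n : ℕ) : XN N p n ⊆ XN N p (n + 1) := by
  induction n with
  | zero =>
    intro x hx
    rw [XN_mem_succ]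
    exact ⟨⟨0, hp⟩, 0, by simp [XN], by simpa [XN] using hx⟩
  | succ n ih =>
    intro x hx
    rw [XN_mem_succ] at hx ⊢
    obtain ⟨j, y, hy, rfl⟩ := hx
    exact ⟨j, y, ih hy, rfl⟩

lemma fin_sub_dvd {p : ℕ} (j j' : Fin p) (h : (p : ℤ) ∣ (j : ℤ) - (j' : ℤ)) : j = j' := by
  have h1 := j.2
  have h2 := j'.2
  obtain ⟨k, hk⟩ := h
  have : k = 0 := by
    by_contra hk0
    rcases lt_or_gt_of_ne hk0 with h | h
    · have : k ≤ -1 := by omega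
      nlinarith
    · have : 1 ≤ k := by omega
      nlinarith
  subst this
  ext; omega

lemma XN_diff (N : ℤ) (p : ℕ) (hN : (p : ℤ) ∣ N) (n : ℕ) : ∀ x ∈ XN N p n, ∀ y ∈ XN N p n, x ≠ y →
    ∃ k : ℕ, ∃ w : ℤ, x - y = N ^ k * w ∧ ¬ (p : ℤ) ∣ w := by
  induction n with
  | zero => intro x hx y hy h; simp [XN] at hx hy; omega
  | succ n ih =>
    intro x hx y hy hne
    rw [XN_mem_succ] at hx hy
    obtain ⟨j, x', hx', rfl⟩ := hx
    obtain ⟨j', y', hy', rfl⟩ := hy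
    by_cases hj : j = j'
    · subst hj
      obtain ⟨k, w, h1, h2⟩ := ih x' hx' y' hy' (by rintro rfl; exact hne rfl)
      exact ⟨k + 1, -w, by linear_combination (-N) * h1, by simpa using h2⟩
    · refine ⟨0, ((j : ℤ) - N * x') - ((j' : ℤ) - N * y'), by ring, fun h => hj ?_⟩
      apply fin_sub_dvd
      have : (j : ℤ) - (j' : ℤ) = ((j : ℤ) - N * x') - ((j' : ℤ) - N * y') + N * (x' - y') := by ring
      rw [this]
      exact dvd_add h (Dvd.dvd.mul_right hN _)

lemma XN_bound (N : ℤ) (p : ℕ) (hN : 2 ≤ N) (hp : 1 ≤ p) (n : ℕ) : ∀ x ∈ XN N p n,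
    (N ^ 2 - 1) * x ≤ (p - 1) * (N ^ (n + 1) - 1) ∧
    -((N ^ 2 - 1) * x) ≤ (p - 1) * (N ^ (n + 1) - N) := by
  induction n with
  | zero =>
    intro x hx; simp [XN] at hx; subst hx
    have : (1 : ℤ) ≤ p := by exact_mod_cast hp
    simp
    nlinarith
  | succ n ih =>
    intro x hx
    rw [XN_mem_succ] at hx
    obtain ⟨j, y, hy, rfl⟩ := hx
    obtain ⟨h1, h2⟩ := ih y hy
    have hj : (j : ℤ) ≤ p - 1 := by have := j.2; omega
    have hj0 : (0 : ℤ) ≤ (j : ℤ) := by omega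
    have hN2 : 0 ≤ N ^ 2 - 1 := by nlinarith
    have e1 := mul_le_mul_of_nonneg_left hj hN2
    have e2 := mul_nonneg hN2 hj0
    have e3 := mul_le_mul_of_nonneg_left h1 (show 0 ≤ N by omega)
    have e4 := mul_le_mul_of_nonneg_left h2 (show 0 ≤ N by omega)
    constructor
    · rw [pow_succ N (n+1)]; nlinarith
    · rw [pow_succ N (n+1)]; nlinarith

lemma a_not_dvd {p : ℕ} {D : Fin p → (Fin 2 → ℤ)} {a : Fin 2 → ℤ} (hZ : ZeroSetCond p D a) (i : Fin 2) :
    ¬ (p : ℤ) ∣ a i := by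
  intro h
  have := Int.le_of_dvd (by have := (hZ.1 i).1; omega) h
  have := (hZ.1 i).2
  omega

lemma suff_zero {p : ℕ} (hp : p.Prime) {D : Fin p → (Fin 2 → ℤ)} {a : Fin 2 → ℤ}
    (hZ : ZeroSetCond p D a) (h l : ℤ) (hd : (p : ℤ) ∣ l * a 1 - h * a 0) (hl : ¬ (p : ℤ) ∣ l)
    (u : ℤ) (hu : ¬ (p : ℤ) ∣ u) :
    mask (digitR D) (((u : ℝ) / p) • ![(l : ℝ), (h : ℝ)]) = 0 := by
  have hpi : Prime (p : ℤ) := Nat.prime_iff_prime_int.mp hp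
  have hp0 : (p : ℝ) ≠ 0 := by exact_mod_cast hp.ne_zero
  have hppos : (0 : ℤ) < p := by exact_mod_cast hp.pos
  have ha := a_not_dvd hZ 0
  have hcop : IsCoprime (p : ℤ) (a 0) := (hpi.coprime_iff_not_dvd).mpr ha
  obtain ⟨x, b, hxb⟩ := hcop
  rw [hZ.2]
  set J : ℤ := (u * l * b) % p with hJ
  have hJ0 : 0 ≤ J := Int.emod_nonneg _ hppos.ne'
  have hJp : J < p := Int.emod_lt_of_pos _ hppos
  have hJd : (p : ℤ) ∣ u * l * b - J := Int.dvd_self_sub_emod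
  have hb : ¬ (p : ℤ) ∣ b := by
    intro hb
    have : (p : ℤ) ∣ 1 := by
      rw [← hxb]; exact dvd_add (dvd_mul_left _ _) (Dvd.dvd.mul_right hb _)
    exact hpi.not_isUnit (isUnit_of_dvd_one this)
  have hJne : J ≠ 0 := by
    intro h0
    rw [h0, sub_zero] at hJd
    rcases hpi.dvd_or_dvd hJd with h | h
    · rcases hpi.dvd_or_dvd h with h | h
      · exact hu h
      · exact hl h
    · exact hb h
  obtain ⟨t, ht⟩ := hJd
  have e0 : (p : ℤ) ∣ u * l - J * a 0 := ⟨u * l * x + t * a 0, by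
    linear_combination (-u * l) * hxb + a 0 * ht⟩
  have e1 : (p : ℤ) ∣ u * h - J * a 1 := by
    obtain ⟨k0, hk0⟩ := e0
    obtain ⟨k1, hk1⟩ := hd
    have : (p : ℤ) ∣ a 0 * (u * h - J * a 1) := ⟨k0 * a 1 - u * k1, by
      linear_combination a 1 * hk0 - u * hk1⟩
    exact (hpi.dvd_or_dvd this).resolve_left ha
  obtain ⟨k0, hk0⟩ := e0
  obtain ⟨k1, hk1⟩ := e1
  refine ⟨J.toNat, by omega, by omega, ![k0, k1], ?_⟩
  have hJc : ((J.toNat : ℕ) : ℝ) = (J : ℝ) := by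
    have : ((J.toNat : ℕ) : ℤ) = J := Int.toNat_of_nonneg hJ0
    exact_mod_cast this
  have r0 : (u : ℝ) * l - J * a 0 = p * k0 := by exact_mod_cast hk0
  have r1 : (u : ℝ) * h - J * a 1 = p * k1 := by exact_mod_cast hk1
  intro i
  rw [hJc]
  fin_cases i
  · simp; field_simp; linarith
  · simp; field_simp; linarith

lemma suff_conv {p : ℕ} (hp : p.Prime) {D : Fin p → (Fin 2 → ℤ)} {a : Fin 2 → ℤ}
    (hZ : ZeroSetCond p D a) (h l : ℤ) (hg : IsCoprime h l) (t : ℝ)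
    (ht : mask (digitR D) (t • ![(l : ℝ), (h : ℝ)]) = 0) :
    ∃ u : ℤ, u ≠ 0 ∧ t = u / p := by
  have hp0 : (p : ℝ) ≠ 0 := by exact_mod_cast hp.ne_zero
  have ht2 := (hZ.2 _).mp ht
  obtain ⟨j, _, _, k, hk⟩ := ht2
  obtain ⟨x, y, hxy⟩ := hg
  have h0 := hk 0
  have h1 := hk 1
  simp at h0 h1
  have hxy' : (x : ℝ) * h + y * l = 1 := by exact_mod_cast hxy
  have e : t = ((x * (j * a 1 + p * k 1) + y * (j * a 0 + p * k 0) : ℤ) : ℝ) / p := by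
    push_cast
    have : t = x * (t * h) + y * (t * l) := by linear_combination (-t) * hxy'
    rw [this, h0, h1]; field_simp
  refine ⟨_, ?_, e⟩
  intro hu
  rw [hu] at e
  simp at e
  rw [e, zero_smul, mask_at_zero hp.ne_zero] at ht
  exact one_ne_zero ht

lemma fsum {p : ℕ} (hp : p.Prime) {D : Fin p → (Fin 2 → ℤ)} {a : Fin 2 → ℤ}
    (hZ : ZeroSetCond p D a) (h l : ℤ) (hd : (p : ℤ) ∣ l * a 1 - h * a 0) (hl : ¬ (p : ℤ) ∣ l)
    (ρ₁ ρ₂ c : ℝ) (hρ : ρ₁ ≠ 0) (mm : ℤ) (hN : ρ₁⁻¹ = ((p * mm : ℤ) : ℝ))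
    (hv : Rmap ρ₁ ρ₂ c ![(l : ℝ), (h : ℝ)] = ρ₁ • ![(l : ℝ), (h : ℝ)]) (n : ℕ) :
    ∀ (s : ℤ) (_ : s = 1 ∨ s = -1) (ξ : Fin 2 → ℝ),
    ∑ x ∈ XN (p * mm) p n, ‖Pp (mask (digitR D)) (Rmap ρ₁ ρ₂ c) n
      (ξ - ((s * mm * x : ℤ) : ℝ) • ![(l : ℝ), (h : ℝ)])‖ ^ 2 = 1 := by
  have hp0 : (p : ℝ) ≠ 0 := by exact_mod_cast hp.ne_zero
  have hpi : Prime (p : ℤ) := Nat.prime_iff_prime_int.mp hp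
  have hN1 : ρ₁ * p * mm = 1 := by
    have : ρ₁ * ρ₁⁻¹ = 1 := mul_inv_cancel₀ hρ
    rw [hN] at this; push_cast at this; linarith
  have hmm : ρ₁ * mm = 1 / p := by field_simp; linarith
  have hmm0 : mm ≠ 0 := by rintro rfl; simp at hN1
  induction n with
  | zero => intro s _ ξ; simp [XN, Pp]
  | succ n ih =>
    intro s hs ξ
    set v : Fin 2 → ℝ := ![(l : ℝ), (h : ℝ)] with hvdef
    rw [XN, Finset.sum_image, Finset.sum_product]
    · have step : ∀ (j : Fin p) (x : ℤ),
          Pp (mask (digitR D)) (Rmap ρ₁ ρ₂ c) (n + 1)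
            (ξ - ((s * mm * ((j : ℤ) - p * mm * x) : ℤ) : ℝ) • v)
          = mask (digitR D) (Rmap ρ₁ ρ₂ c ξ + (j : ℝ) • ((-(s : ℝ) / p) • v)) *
            Pp (mask (digitR D)) (Rmap ρ₁ ρ₂ c) n
              ((Rmap ρ₁ ρ₂ c ξ + (j : ℝ) • ((-(s : ℝ) / p) • v)) - (((-s) * mm * x : ℤ) : ℝ) • v) := by
        intro j x
        have e : Rmap ρ₁ ρ₂ c (ξ - ((s * mm * ((j : ℤ) - p * mm * x) : ℤ) : ℝ) • v)
          = (Rmap ρ₁ ρ₂ c ξ + (j : ℝ) • ((-(s : ℝ) / p) • v)) - (((-s) * mm * x : ℤ) : ℝ) • v := by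
          have coeff : ((s * mm * ((j : ℤ) - p * mm * x) : ℤ) : ℝ) * ρ₁
              = -((j : ℝ) * (-(s : ℝ) / p)) + (((-s) * mm * x : ℤ) : ℝ) := by
            push_cast
            have : -((j : ℝ) * (-(s : ℝ) / p)) = s * j * (1 / p) := by ring
            rw [this]
            linear_combination ((s:ℝ) * j) * hmm - s * mm * x * hN1
          rw [Rmap_sub, Rmap_smul, hv, smul_smul, smul_smul, coeff]
          module
        rw [Pp_succ', e]
        congr 1
        rw [sub_eq_add_neg]
        apply mask_periodic
        intro i
        fin_cases i
        · exact ⟨-((-s) * mm * x) * l, by simp [hvdef]⟩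
        · exact ⟨-((-s) * mm * x) * h, by simp [hvdef]⟩
      have step2 : ∀ j : Fin p, ∑ x ∈ XN (p * mm) p n, ‖Pp (mask (digitR D)) (Rmap ρ₁ ρ₂ c) (n + 1)
            (ξ - ((s * mm * ((j : ℤ) - p * mm * x) : ℤ) : ℝ) • v)‖ ^ 2
          = ‖mask (digitR D) (Rmap ρ₁ ρ₂ c ξ + (j : ℝ) • ((-(s : ℝ) / p) • v))‖ ^ 2 := by
        intro j
        simp only [step j, norm_mul, mul_pow]
        rw [← Finset.mul_sum, ih (-s) (by omega), mul_one]
      simp only [step2]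
      apply mask_sum hp.ne_zero
      intro j j' hjj
      rw [smul_smul]
      have := suff_zero hp hZ h l hd hl (-s * ((j : ℤ) - (j' : ℤ))) (by
        intro hdv
        apply hjj
        apply fin_sub_dvd
        rcases hs with rfl | rfl
        · simpa using (dvd_neg.mpr hdv)
        · simpa using hdv)
      rw [← this]
      congr 2
      push_cast
      field_simp
    · rintro ⟨j, x⟩ _ ⟨j', x'⟩ _ heq
      simp only at heq
      have hj : j = j' := fin_sub_dvd _ _ ⟨mm * (x - x'), by linear_combination heq⟩
      subst hj
      have : (p : ℤ) * mm * (x - x') = 0 := by linear_combination -heq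
      have h2 : (p : ℤ) * mm ≠ 0 := mul_ne_zero hpi.ne_zero hmm0
      have := (mul_eq_zero.mp this).resolve_left h2
      ext <;> simp; omega

lemma suff_limit {V : Type*} [AddCommGroup V] (F : V → ℂ) (P : ℕ → V → ℂ) (R : ℕ → V → V) (S : Set V)
    (Sn : ℕ → Finset V)
    (h1 : ∀ l ∈ S, ∀ᶠ n in Filter.atTop, l ∈ Sn n) (h2 : ∀ n, (Sn n : Set V) ⊆ S) (ξ : V)
    (hs : ∀ n, ∑ l ∈ Sn n, ‖P n (ξ - l)‖ ^ 2 = 1)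
    (hF : ∀ n η, F η = P n η * F (R n η))
    (ε : ℝ) (hε : 0 < ε) (hlow : ∀ᶠ n in Filter.atTop, ∀ l ∈ Sn n, ε ≤ ‖F (R n (ξ - l))‖)
    (hc : ∀ η, Filter.Tendsto (fun n => F (R n η)) Filter.atTop (nhds 1))
    (hsum : Summable (fun l : S => ‖F (ξ - l)‖ ^ 2)) :
    HasSum (fun l : S => ‖F (ξ - l)‖ ^ 2) 1 := by
  classical
  let f : ℕ → S → ℝ := fun n l => if (l : V) ∈ Sn n then ‖P n (ξ - l)‖ ^ 2 else 0
  have t := tendsto_tsum_of_dominated_convergence (𝓕 := Filter.atTop) (f := f)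
    (g := fun l : S => ‖F (ξ - l)‖ ^ 2)
    (bound := fun l : S => (ε ^ 2)⁻¹ * ‖F (ξ - l)‖ ^ 2) (hsum.mul_left _) ?_ ?_
  · have e : ∀ n, ∑' l : S, f n l = 1 := by
      intro n
      rw [← hs n]
      have : ∑' l : S, f n l = ∑' l : V, if l ∈ Sn n then ‖P n (ξ - l)‖ ^ 2 else 0 := by
        rw [tsum_subtype S (fun l => if l ∈ Sn n then ‖P n (ξ - l)‖ ^ 2 else 0)]
        congr 1
        ext l
        by_cases hl : l ∈ S
        · simp [hl]
        · have : l ∉ Sn n := fun h => hl (h2 n h)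
          simp [hl, this]
      rw [this, tsum_eq_sum (s := Sn n)]
      · exact Finset.sum_congr rfl (fun l hl => by simp [hl])
      · intro l hl; simp [hl]
    simp only [e] at t
    have := tendsto_nhds_unique t tendsto_const_nhds
    rw [← this]
    exact hsum.hasSum
  · intro l
    have a1 : Filter.Tendsto (fun n => ‖F (ξ - l)‖ ^ 2 / ‖F (R n (ξ - l))‖ ^ 2) Filter.atTop
        (nhds (‖F (ξ - l)‖ ^ 2 / ‖(1:ℂ)‖ ^ 2)) :=
      tendsto_const_nhds.div ((hc _).norm.pow 2) (by simp)
    simp at a1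
    refine a1.congr' ?_
    filter_upwards [h1 l l.2, (hc (ξ - l)).eventually_ne one_ne_zero] with n hn hne
    simp only [f, hn, if_true]
    rw [hF n (ξ - l), norm_mul, mul_pow]
    have : ‖F (R n (ξ - l))‖ ≠ 0 := by simpa using hne
    field_simp
  · filter_upwards [hlow] with n hn l
    by_cases hl : (l : V) ∈ Sn n
    · simp only [f, hl, if_true]
      rw [Real.norm_of_nonneg (by positivity), hF n (ξ - l), norm_mul, mul_pow]
      have h3 := hn l hl
      have : ε ^ 2 ≤ ‖F (R n (ξ - l))‖ ^ 2 := by gcongr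
      rw [inv_mul_eq_div, le_div_iff₀ (by positivity)]
      gcongr
    · simp only [f, hl, if_false, norm_zero]; positivity

lemma Rmap_iter_eigen (ρ₁ ρ₂ c : ℝ) (v : Fin 2 → ℝ) (hv : Rmap ρ₁ ρ₂ c v = ρ₁ • v) (n : ℕ) (t : ℝ) :
    (Rmap ρ₁ ρ₂ c)^[n] (t • v) = (ρ₁ ^ n * t) • v := by
  induction n with
  | zero => simp
  | succ n ih =>
    rw [Function.iterate_succ_apply', ih, Rmap_smul, hv, smul_smul]
    congr 1; ring

lemma XN_mono_le (N : ℤ) (p : ℕ) (hp : 0 < p) {n k : ℕ} (h : n ≤ k) : XN N p n ⊆ XN N p k := by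
  induction h with
  | refl => exact fun _ h => h
  | step _ ih => exact ih.trans (XN_mono N p hp _)

lemma sufficiency (p : ℕ) (hp : p.Prime) (ρ₁ ρ₂ c : ℝ)
    (hρ10 : 0 < ρ₁) (hρ11 : ρ₁ < 1) (hρ20 : 0 < ρ₂) (hρ21 : ρ₂ < 1) (hρ : ρ₁ ≠ ρ₂)
    (D : Fin p → (Fin 2 → ℤ))
    (a : Fin 2 → ℤ) (hZ : ZeroSetCond p D a)
    (μ : Measure (Fin 2 → ℝ)) (hμ : IsSelfAffine μ (Mupper ρ₁ ρ₂ c) (digitR D))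
    (hrat : ∃ q : ℚ, c / (ρ₁⁻¹ - ρ₂⁻¹) = (q : ℝ))
    (hnE : c / (ρ₁⁻¹ - ρ₂⁻¹) ∉ Ea p a)
    (mm : ℤ) (hN : ρ₁⁻¹ = ((p * mm : ℤ) : ℝ)) : IsSpectral μ := by
  classical
  have hprob := hμ.1
  have hpi : Prime (p : ℤ) := Nat.prime_iff_prime_int.mp hp
  have hp0 : (p : ℝ) ≠ 0 := by exact_mod_cast hp.ne_zero
  have hppos : (0 : ℤ) < p := by exact_mod_cast hp.pos
  obtain ⟨q, hq⟩ := hrat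
  obtain ⟨h, hh⟩ : ∃ h : ℤ, h = q.num := ⟨_, rfl⟩
  obtain ⟨l, hl⟩ : ∃ l : ℤ, l = q.den := ⟨_, rfl⟩
  have hl0 : l ≠ 0 := by rw [hl]; exact_mod_cast q.den_nz
  have hlr : (l : ℝ) ≠ 0 := by exact_mod_cast hl0
  have hcop : IsCoprime h l := by
    rw [hh, hl]; exact q.isCoprime_num_den
  have hqr : c / (ρ₁⁻¹ - ρ₂⁻¹) = (h : ℝ) / l := by
    rw [hq, hh, hl]; exact_mod_cast (Rat.num_div_den q).symm
  have hd : (p : ℤ) ∣ l * a 1 - h * a 0 := by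
    by_contra hnd
    exact hnE (Or.inl ⟨h, l, Int.isCoprime_iff_gcd_eq_one.mp hcop, hnd, hqr⟩)
  have hpl : ¬ (p : ℤ) ∣ l := by
    intro hpl
    have h1 : (p : ℤ) ∣ h * a 0 := by
      have := dvd_sub (Dvd.dvd.mul_right hpl (a 1)) hd
      simpa using this
    have h2 := (hpi.dvd_or_dvd h1).resolve_right (a_not_dvd hZ 0)
    exact hpi.not_isUnit (hcop.isUnit_of_dvd' h2 hpl)
  set v : Fin 2 → ℝ := ![(l : ℝ), (h : ℝ)] with hvdef
  have hv : Rmap ρ₁ ρ₂ c v = ρ₁ • v := by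
    have h3 : ρ₁⁻¹ - ρ₂⁻¹ ≠ 0 := by
      intro h; apply hρ; exact inv_injective (sub_eq_zero.mp h)
    have h4 : c * l = h * (ρ₁⁻¹ - ρ₂⁻¹) := by
      rw [div_eq_div_iff h3 hlr] at hqr; linarith
    ext i
    fin_cases i
    · simp [Rmap, hvdef]
    · simp only [Rmap, hvdef]
      simp
      have : c * ρ₁ * l = ρ₁ * (h * (ρ₁⁻¹ - ρ₂⁻¹)) := by rw [← h4]; ring
      rw [this]; field_simp; ring
  have hN1 : ρ₁ * p * mm = 1 := by
    have : ρ₁ * ρ₁⁻¹ = 1 := mul_inv_cancel₀ hρ10.ne'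
    rw [hN] at this; push_cast at this; linarith
  have hmmpos : 0 < mm := by
    by_contra hneg
    have h1 : (mm : ℝ) ≤ 0 := by exact_mod_cast not_lt.mp hneg
    have h2 : 0 < ρ₁ * p := by have : (0:ℝ) < p := by exact_mod_cast hp.pos
                               positivity
    nlinarith
  have hmm1 : (1 : ℝ) ≤ mm := by exact_mod_cast hmmpos
  obtain ⟨N, hNdef⟩ : ∃ N : ℤ, N = p * mm := ⟨_, rfl⟩
  have hρN : ρ₁ * N = 1 := by rw [hNdef]; push_cast; linarith
  have hN2 : 2 ≤ N := by
    have : (2 : ℤ) ≤ p := by exact_mod_cast hp.two_le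
    rw [hNdef]; nlinarith
  have hN2r : (2 : ℝ) ≤ N := by exact_mod_cast hN2
  have hfs : ∀ n ξ, ∑ x ∈ XN N p n, ‖Pp (mask (digitR D)) (Rmap ρ₁ ρ₂ c) n
      (ξ - ((mm * x : ℤ) : ℝ) • v)‖ ^ 2 = 1 := by
    intro n ξ
    have := fsum hp hZ h l hd hpl ρ₁ ρ₂ c hρ10.ne' mm hN hv n 1 (Or.inl rfl) ξ
    rw [← hNdef] at this
    simpa only [one_mul] using this
  have hFeq : ∀ ξ, ftMeasure μ ξ = mask (digitR D) (Rmap ρ₁ ρ₂ c ξ) * ftMeasure μ (Rmap ρ₁ ρ₂ c ξ) :=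
    ft_selfaffine ρ₁ ρ₂ c hρ10.ne' hρ20.ne' (digitR D) μ hμ
  have hRt := Rmap_iter_tendsto ρ₁ ρ₂ c hρ10 hρ11 hρ20 hρ21 hρ
  have hinj : Function.Injective (fun x : ℤ => ((mm * x : ℤ) : ℝ) • v) := by
    intro x y hxy
    have := congrFun hxy 0
    simp [hvdef, hl0, hmmpos.ne'] at this
    exact this
  let Sn : ℕ → Finset (Fin 2 → ℝ) := fun n => (XN N p n).image (fun x : ℤ => ((mm * x : ℤ) : ℝ) • v)
  let S : Set (Fin 2 → ℝ) := ⋃ n, (Sn n : Set (Fin 2 → ℝ))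
  have hScount : S.Countable := Set.countable_iUnion (fun n => (Sn n).countable_toSet)
  have hSmono : ∀ {n k}, n ≤ k → Sn n ⊆ Sn k := fun h =>
    Finset.image_subset_image (XN_mono_le N p hp.pos h)
  have hortho : IsOrthoSet μ S := by
    intro x hx y hy hne
    obtain ⟨n1, hx⟩ := Set.mem_iUnion.mp hx
    obtain ⟨n2, hy⟩ := Set.mem_iUnion.mp hy
    have hx := hSmono (le_max_left n1 n2) hx
    have hy := hSmono (le_max_right n1 n2) hy
    obtain ⟨x', hx', rfl⟩ := Finset.mem_image.mp hx
    obtain ⟨y', hy', rfl⟩ := Finset.mem_image.mp hy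
    obtain ⟨k, w, hk, hw⟩ := XN_diff N p (hNdef ▸ dvd_mul_right _ _) _ x' hx' y' hy'
      (by rintro rfl; exact hne rfl)
    apply ft_zero_of_mask _ _ _ hFeq k
    rw [← sub_smul, Rmap_iter_eigen _ _ _ _ hv, ← suff_zero hp hZ h l hd hpl w hw]
    congr 2
    have : (x' : ℝ) - y' = N ^ k * w := by exact_mod_cast hk
    push_cast
    rw [← mul_sub, this]
    have h5 : ρ₁ ^ k * (N : ℝ) ^ k = 1 := by rw [← mul_pow, hρN, one_pow]
    rw [eq_div_iff hp0, pow_succ]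
    linear_combination w * h5 + ρ₁ ^ k * N ^ k * w * hN1
  have hnz : ∀ t : ℝ, |t| < 1 → ftMeasure μ (t • v) ≠ 0 := by
    intro t ht h0
    obtain ⟨n, hn⟩ := mask_of_ft_zero _ _ _ hFeq (ft_cont μ) (ft_zero μ) hRt _ h0
    rw [Rmap_iter_eigen _ _ _ _ hv] at hn
    obtain ⟨u, hu, hut⟩ := suff_conv hp hZ h l hcop _ hn
    have hu1 : (1 : ℝ) ≤ |(u : ℝ)| := by exact_mod_cast Int.one_le_abs hu
    rw [eq_div_iff hp0] at hut
    rw [← hut, abs_mul, abs_mul, abs_of_pos (pow_pos hρ10 _)] at hu1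
    have h6 : ρ₁ ^ (n + 1) ≤ ρ₁ := by
      rw [pow_succ]; exact mul_le_of_le_one_left hρ10.le (pow_le_one₀ hρ10.le hρ11.le)
    have hpp : (0 : ℝ) < p := by exact_mod_cast hp.pos
    rw [abs_of_pos hpp] at hu1
    have h7 : ρ₁ ^ (n + 1) * p ≤ 1 := by
      calc ρ₁ ^ (n + 1) * p ≤ ρ₁ * p := by gcongr
        _ ≤ ρ₁ * p * mm := le_mul_of_one_le_right (by positivity) hmm1
        _ = 1 := hN1
    have h8 : 0 < ρ₁ ^ (n + 1) * p := by positivity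
    nlinarith [abs_nonneg t]
  have hbd : ∀ n, ∀ x ∈ XN N p n, |ρ₁ ^ n * ((mm * x : ℤ) : ℝ)| ≤ N / (N + 1) := by
    intro n x hx
    obtain ⟨b1, b2⟩ := XN_bound N p hN2 hp.one_le n x hx
    have c1 : ((N : ℝ) ^ 2 - 1) * x ≤ (p - 1) * (N ^ (n + 1) - 1) := by exact_mod_cast b1
    have c2 : -(((N : ℝ) ^ 2 - 1) * x) ≤ (p - 1) * (N ^ (n + 1) - N) := by exact_mod_cast b2
    have hp1 : (1 : ℝ) ≤ p := by exact_mod_cast hp.one_le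
    have hN3 : (0 : ℝ) < N ^ 2 - 1 := by nlinarith
    have c3 : ((N : ℝ) ^ 2 - 1) * |(x : ℝ)| ≤ (p - 1) * N ^ (n + 1) := by
      rw [← abs_of_pos hN3, ← abs_mul, abs_le]
      constructor <;> nlinarith
    have h5 : ρ₁ ^ n * (N : ℝ) ^ n = 1 := by rw [← mul_pow, hρN, one_pow]
    have hmm0 : (0 : ℝ) < mm := by linarith
    push_cast
    rw [abs_mul, abs_mul, abs_of_pos (pow_pos hρ10 _), abs_of_pos hmm0, le_div_iff₀ (by linarith)]
    have c4 := mul_le_mul_of_nonneg_left c3 (show 0 ≤ ρ₁ ^ n * mm by positivity)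
    have c5 : ρ₁ ^ n * mm * ((p - 1) * (N : ℝ) ^ (n + 1)) = (N - mm) * N := by
      have : (N : ℝ) = p * mm := by exact_mod_cast hNdef
      rw [pow_succ]
      calc ρ₁ ^ n * mm * ((p - 1) * ((N : ℝ) ^ n * N)) = (ρ₁ ^ n * (N : ℝ) ^ n) * ((p * mm - mm) * N) := by ring
        _ = _ := by rw [h5, ← this]; ring
    rw [c5] at c4
    have c6 : (N - 1 : ℝ) * (ρ₁ ^ n * (mm * |(x : ℝ)|) * (N + 1)) ≤ (N - 1) * N := by nlinarith
    exact le_of_mul_le_mul_left c6 (by linarith)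
  have hκ : (N : ℝ) / (N + 1) < 1 := by rw [div_lt_one (by linarith)]; linarith
  have hκ0 : (0 : ℝ) ≤ N / (N + 1) := by apply div_nonneg <;> linarith
  obtain ⟨K, hK⟩ : ∃ K : Set (Fin 2 → ℝ), K = (fun t : ℝ => t • v) '' Set.Icc (-(N / (N + 1) : ℝ)) (N / (N + 1)) := ⟨_, rfl⟩
  have hKc : IsCompact K := by rw [hK]; exact isCompact_Icc.image (by fun_prop)
  have hU : IsOpen {η | ftMeasure μ η ≠ 0} := isOpen_ne_fun (ft_cont μ) continuous_const
  have hKU : K ⊆ {η | ftMeasure μ η ≠ 0} := by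
    rw [hK]
    rintro _ ⟨t, ht, rfl⟩
    exact hnz t (lt_of_le_of_lt (abs_le.mpr ht) hκ)
  obtain ⟨δ, hδ, hδU⟩ := hKc.exists_cthickening_subset_open hU hKU
  have hKne : (Metric.cthickening δ K).Nonempty := by
    refine ⟨(0:ℝ) • v, Metric.self_subset_cthickening K ?_⟩
    rw [hK]; exact ⟨0, ⟨by linarith, hκ0⟩, rfl⟩
  obtain ⟨η0, hη0, hmin⟩ := hKc.cthickening.exists_isMinOn hKne
    ((ft_cont μ).norm.continuousOn (s := Metric.cthickening δ K))
  apply spectral_of_sum μ S hScount hortho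
  intro ξ
  apply suff_limit (ftMeasure μ) (Pp (mask (digitR D)) (Rmap ρ₁ ρ₂ c)) (fun n => (Rmap ρ₁ ρ₂ c)^[n]) S Sn
    (ε := ‖ftMeasure μ η0‖)
  · intro x hx
    obtain ⟨n, hn⟩ := Set.mem_iUnion.mp hx
    filter_upwards [Filter.eventually_ge_atTop n] with k hk
    exact hSmono hk hn
  · exact fun n => Set.subset_iUnion (fun n => (Sn n : Set (Fin 2 → ℝ))) n
  · intro n
    rw [Finset.sum_image (fun x _ y _ h => hinj h)]
    exact hfs n ξ
  · intro n η
    exact ft_iter _ _ _ hFeq n η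
  · exact norm_pos_iff.mpr (hδU hη0)
  · have := (hRt ξ).eventually (Metric.closedBall_mem_nhds 0 hδ)
    filter_upwards [this] with n hn x hx
    obtain ⟨y, hy, rfl⟩ := Finset.mem_image.mp hx
    apply hmin
    rw [Rmap_iter_sub, Rmap_iter_eigen _ _ _ _ hv]
    apply Metric.mem_cthickening_of_dist_le _ (-((ρ₁ ^ n * ((mm * y : ℤ) : ℝ)) • v))
    · rw [hK]
      refine ⟨-(ρ₁ ^ n * ((mm * y : ℤ) : ℝ)), ?_, by simp⟩
      have := abs_le.mp (hbd n y hy)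
      constructor <;> linarith
    · rw [dist_eq_norm]
      simpa using hn
  · intro η
    rw [← ft_zero μ]
    exact ((ft_cont μ).tendsto 0).comp (hRt η)
  · exact (bessel_summable μ S hortho ξ).1

lemma exists_val {p : ℕ} (hp : p.Prime) : ∃ B : ValuationSubring ℝ,
    (B.valuation (p : ℝ) < 1) ∧ (∀ u : ℤ, B.valuation (u : ℝ) ≤ 1) ∧
    (∀ u : ℤ, ¬ (p : ℤ) ∣ u → B.valuation (u : ℝ) = 1) := by
  have hpi : Prime (p : ℤ) := Nat.prime_iff_prime_int.mp hp
  let A : Subring ℝ := (Int.castRingHom ℝ).range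
  let P : A := ⟨(p : ℝ), ⟨p, by simp⟩⟩
  have hI : Ideal.span {P} ≠ ⊤ := by
    rw [Ne, Ideal.span_singleton_eq_top]
    rintro hu
    obtain ⟨⟨_, ⟨z, rfl⟩⟩, hz⟩ := hu.exists_right_inv
    have := congrArg Subtype.val hz
    simp [P] at this
    have h2 : (p : ℤ) * z = 1 := by exact_mod_cast this
    exact hpi.not_isUnit (IsUnit.of_mul_eq_one _ h2)
  obtain ⟨B, hB1, hB2⟩ := Ideal.image_subset_nonunits_valuationSubring _ hI
  have h1 : B.valuation (p : ℝ) < 1 := by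
    rw [← ValuationSubring.mem_nonunits_iff]
    exact hB2 ⟨P, Ideal.subset_span rfl, rfl⟩
  have h2 : ∀ u : ℤ, B.valuation (u : ℝ) ≤ 1 := by
    intro u
    rw [ValuationSubring.valuation_le_one_iff]
    exact hB1 ⟨u, by simp⟩
  refine ⟨B, h1, h2, ?_⟩
  intro u hu
  obtain ⟨x, y, hxy⟩ := (hpi.coprime_iff_not_dvd).mpr hu
  apply le_antisymm (h2 u)
  by_contra hlt
  push Not at hlt
  have e : (1 : ℝ) = x * p + y * u := by exact_mod_cast hxy.symm
  have : B.valuation (1 : ℝ) < 1 := by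
    rw [e]
    apply lt_of_le_of_lt (Valuation.map_add _ _ _)
    rw [max_lt_iff]
    constructor
    · rw [map_mul]
      exact mul_lt_one_of_nonneg_of_lt_one_right (h2 x) (zero_le) h1
    · rw [map_mul]
      exact mul_lt_one_of_nonneg_of_lt_one_right (h2 y) (zero_le) hlt
  rw [map_one] at this
  exact lt_irrefl _ this

/-- level relation -/
def Lv (p : ℕ) (θ : ℝ) (n : ℕ) (x y : ℝ) : Prop := ∃ u : ℤ, ¬ (p : ℤ) ∣ u ∧ x - y = θ ^ n * u

lemma Lv_symm {p : ℕ} {θ : ℝ} {n : ℕ} {x y : ℝ} (h : Lv p θ n x y) : Lv p θ n y x := by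
  obtain ⟨u, hu, e⟩ := h
  exact ⟨-u, by simpa using hu, by push_cast; linarith⟩

lemma Lv_ne {p : ℕ} {θ : ℝ} (hθ : θ ≠ 0) {n : ℕ} {x y : ℝ} (h : Lv p θ n x y) : x ≠ y := by
  obtain ⟨u, hu, e⟩ := h
  rintro rfl
  rw [sub_self] at e
  have := (mul_eq_zero.mp e.symm).resolve_left (pow_ne_zero _ hθ)
  apply hu
  have : u = 0 := by exact_mod_cast this
  rw [this]; exact dvd_zero _

lemma connect (p : ℕ) (θ : ℝ) (T : Set ℝ)
    (H1 : ∀ x ∈ T, ∀ y ∈ T, x ≠ y → ∃ n, Lv p θ n x y)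
    (good : ℕ → ℕ → Prop) (htr : ∀ i j k, good i j → good j k → good i k)
    (hsh : ∀ x ∈ T, ∀ y ∈ T, ∀ z ∈ T, ∀ i j, Lv p θ i x y → Lv p θ j y z → good i j)
    {x y z w : ℝ} (hx : x ∈ T) (hy : y ∈ T) (hz : z ∈ T) (hw : w ∈ T) {i j : ℕ}
    (h1 : Lv p θ i x y) (h2 : Lv p θ j z w) : good i j := by
  by_cases hyz : y = z
  · subst hyz; exact hsh x hx y hy w hw i j h1 h2
  · obtain ⟨k, hk⟩ := H1 y hy z hz hyz
    exact htr _ _ _ (hsh x hx y hy z hz i k h1 hk) (hsh y hy z hz w hw k j hk h2)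

lemma poly_three {F : Type*} [Field F] (a b c : F) (ha : a ≠ 0) (hb : b ≠ 0) (i j k : ℕ)
    (h : (Polynomial.C a * Polynomial.X ^ i + Polynomial.C b * Polynomial.X ^ j
      - Polynomial.C c * Polynomial.X ^ k : Polynomial F) = 0) : i = j := by
  by_contra hij
  have e1 := congrArg (fun P => Polynomial.coeff P i) h
  have e2 := congrArg (fun P => Polynomial.coeff P j) h
  simp only [Polynomial.coeff_sub, Polynomial.coeff_add, Polynomial.coeff_C_mul,
    Polynomial.coeff_X_pow, Polynomial.coeff_zero] at e1 e2
  by_cases hik : i = k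
  · have hjk : j ≠ k := by omega
    rw [if_neg (Ne.symm hij), if_neg hjk] at e2
    simp at e2; exact hb e2
  · rw [if_neg hij, if_neg hik] at e1
    simp at e1; exact ha e1

lemma T_infinite (p : ℕ) (θ : ℝ) (hθ : 1 < θ) (T : Set ℝ)
    (H2 : ∀ k, 1 ≤ k → ∃ x ∈ T, ∃ y ∈ T, Lv p θ k x y) : T.Infinite := by
  intro hfin
  obtain ⟨b, hb⟩ := hfin.isBounded.subset_closedBall 0
  obtain ⟨k, hk⟩ := pow_unbounded_of_one_lt (2 * b) hθ
  obtain ⟨x, hx, y, hy, u, hu, e⟩ := H2 (k + 1) (by omega)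
  have hx2 := hb hx
  have hy2 := hb hy
  rw [mem_closedBall_zero_iff, Real.norm_eq_abs] at hx2 hy2
  have hu1 : (1 : ℝ) ≤ |(u : ℝ)| := by
    have : u ≠ 0 := by rintro rfl; exact hu (dvd_zero _)
    exact_mod_cast Int.one_le_abs this
  have h3 : |x - y| ≤ 2 * b := by have := abs_sub x y; linarith
  rw [e, abs_mul, abs_of_pos (by positivity)] at h3
  have h4 : θ ^ k ≤ θ ^ (k + 1) := pow_le_pow_right₀ hθ.le (by omega)
  have h5 : 0 < θ ^ (k + 1) := by positivity
  nlinarith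

lemma mem_adj {F k : Type*} [Field F] [Field k] [Algebra F k] (s : k) (n : ℕ) (u : ℤ) :
    s ^ n * (u : k) ∈ Algebra.adjoin F {s} :=
  Subalgebra.mul_mem _ (Subalgebra.pow_mem _ (Algebra.subset_adjoin (Set.mem_singleton s)) n)
    (Subalgebra.intCast_mem _ u)

set_option maxHeartbeats 1000000 in
lemma val_one_absurd {p : ℕ} (hp : p.Prime) (θ : ℝ) (hθ : 1 < θ) (T : Set ℝ)
    (H1 : ∀ x ∈ T, ∀ y ∈ T, x ≠ y → ∃ n, Lv p θ n x y)
    (H2 : ∀ k, 1 ≤ k → ∃ x ∈ T, ∃ y ∈ T, Lv p θ k x y)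
    (B : ValuationSubring ℝ) (hB1 : B.valuation (p : ℝ) < 1) (hB2 : ∀ u : ℤ, B.valuation (u : ℝ) ≤ 1)
    (hB3 : ∀ u : ℤ, ¬ (p : ℤ) ∣ u → B.valuation (u : ℝ) = 1)
    (hv : B.valuation θ = 1) : False := by
  have hpf : Fact p.Prime := ⟨hp⟩
  have hθB : θ ∈ B := (B.valuation_le_one_iff θ).mp hv.le
  let t : B := ⟨θ, hθB⟩
  let res := IsLocalRing.residue B
  have hpk : ((p : ℕ) : IsLocalRing.ResidueField B) = 0 := by
    have : res (p : B) = 0 := by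
      rw [IsLocalRing.residue_eq_zero_iff, ValuationSubring.valuation_lt_one_iff]
      simpa using hB1
    simpa using this
  have hchar : CharP (IsLocalRing.ResidueField B) p := (CharP.charP_iff_prime_eq_zero hp).mpr hpk
  let _ : Algebra (ZMod p) (IsLocalRing.ResidueField B) := ZMod.algebra _ p
  have hres : ∀ (n : ℕ) (u : ℤ), res (t ^ n * (u : B)) = (res t) ^ n * (u : IsLocalRing.ResidueField B) := by
    intro n u; simp
  have hmem : ∀ x ∈ T, ∀ y ∈ T, x - y ∈ B := by
    intro x hx y hy
    by_cases hxy : x = y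
    · rw [hxy, sub_self]; exact zero_mem _
    · obtain ⟨n, u, _, e⟩ := H1 x hx y hy hxy
      rw [e]
      exact (t ^ n * (u : B)).2
  by_cases htr : Transcendental (ZMod p) (res t)
  · -- all levels equal
    obtain ⟨x, hx, y, hy, h1⟩ := H2 1 le_rfl
    obtain ⟨z, hz, w, hw, h2⟩ := H2 2 (by norm_num)
    have := connect p θ T H1 (fun i j => i = j) (fun i j k h1 h2 => h1.trans h2) ?_ hx hy hz hw h1 h2
    · omega
    · rintro x hx y hy z hz i j ⟨a, ha, e1⟩ ⟨b, hb, e2⟩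
      obtain ⟨k, c, e3⟩ : ∃ (k : ℕ) (c : ℤ), x - z = θ ^ k * c := by
        by_cases hxz : x = z
        · exact ⟨0, 0, by simp [hxz]⟩
        · obtain ⟨n, u, _, e⟩ := H1 x hx z hz hxz
          exact ⟨n, u, e⟩
      have e4 : t ^ i * (a : B) + t ^ j * (b : B) = t ^ k * (c : B) := by
        apply Subtype.ext
        simp [t]
        linarith
      have e5 := congrArg res e4
      rw [map_add, hres, hres, hres] at e5
      apply poly_three (F := ZMod p) (a : ZMod p) (b : ZMod p) (c : ZMod p) _ _ i j k
      · apply transcendental_iff.mp htr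
        simp
        rw [sub_eq_zero]
        linear_combination e5
      · rwa [Ne, ZMod.intCast_zmod_eq_zero_iff_dvd]
      · rwa [Ne, ZMod.intCast_zmod_eq_zero_iff_dvd]
  · have halg : IsAlgebraic (ZMod p) (res t) := by
      by_contra h; exact htr h
    have hitg := isAlgebraic_iff_isIntegral.mp halg
    have hfg := hitg.fg_adjoin_singleton
    have hfin : Finite (Algebra.adjoin (ZMod p) {res t}) := by
      have : Module.Finite (ZMod p) (Algebra.adjoin (ZMod p) {res t}) := Module.Finite.iff_fg.mpr hfg
      exact Module.finite_of_finite (ZMod p)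
    apply T_infinite p θ hθ T H2
    obtain ⟨x0, hx0, _⟩ := H2 1 le_rfl
    have hmem2 : ∀ x : T, res ⟨x - x0, hmem x x.2 x0 hx0⟩ ∈ Algebra.adjoin (ZMod p) {res t} := by
      intro x
      by_cases hxy : (x : ℝ) = x0
      · have : (⟨x - x0, hmem x x.2 x0 hx0⟩ : B) = 0 := by apply Subtype.ext; simp [hxy]
        rw [this, map_zero]; exact zero_mem _
      · obtain ⟨n, u, _, e⟩ := H1 x x.2 x0 hx0 hxy
        have : (⟨x - x0, hmem x x.2 x0 hx0⟩ : B) = t ^ n * (u : B) := by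
          apply Subtype.ext; simp [t, e]
        rw [this, hres]
        exact mem_adj _ _ _
    rw [← Set.finite_coe_iff]
    apply Finite.of_injective (β := Algebra.adjoin (ZMod p) {res t})
      (fun x : T => ⟨res ⟨x - x0, hmem x x.2 x0 hx0⟩, hmem2 x⟩)
    intro x y hxy
    by_contra hne
    have hne2 : (x : ℝ) ≠ y := fun h => hne (Subtype.ext h)
    obtain ⟨n, u, hu, e⟩ := H1 x x.2 y y.2 hne2
    have h3 := congrArg Subtype.val hxy
    simp only at h3
    rw [← sub_eq_zero, ← map_sub, IsLocalRing.residue_eq_zero_iff, ValuationSubring.valuation_lt_one_iff] at h3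
    have h4 : (((⟨x - x0, hmem x x.2 x0 hx0⟩ : B) - ⟨y - x0, hmem y y.2 x0 hx0⟩ : B) : ℝ) = θ ^ n * u := by
      rw [← e]; simp
    rw [h4, map_mul, map_pow, hv, hB3 u hu] at h3
    simp at h3

lemma rat_of_val {p : ℕ} (θ : ℝ) (hθ : 1 < θ) (T : Set ℝ)
    (H1 : ∀ x ∈ T, ∀ y ∈ T, x ≠ y → ∃ n, Lv p θ n x y)
    (H2 : ∀ k, 1 ≤ k → ∃ x ∈ T, ∃ y ∈ T, Lv p θ k x y)
    (B : ValuationSubring ℝ)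
    (hB3 : ∀ u : ℤ, ¬ (p : ℤ) ∣ u → B.valuation (u : ℝ) = 1)
    (hinj : Function.Injective (fun n : ℕ => B.valuation θ ^ n)) : ∃ q : ℚ, θ = q := by
  have hθ0 : 0 < θ := by linarith
  obtain ⟨x, hx, y, hy, h1⟩ := H2 1 le_rfl
  obtain ⟨z, hz, w, hw, h2⟩ := H2 2 (by norm_num)
  have := connect p θ T H1 (fun i j => ∃ q : ℚ, θ ^ i = q * θ ^ j) ?_ ?_ hz hw hx hy h2 h1
  · obtain ⟨q, hq⟩ := this
    refine ⟨q, ?_⟩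
    have : θ * θ = q * θ := by linarith
    exact mul_right_cancel₀ hθ0.ne' this
  · rintro i j k ⟨q, hq⟩ ⟨r, hr⟩
    exact ⟨q * r, by rw [hq, hr]; push_cast; ring⟩
  · rintro x hx y hy z hz i j ⟨a, ha, e1⟩ ⟨b, hb, e2⟩
    have va : B.valuation (x - y) = B.valuation θ ^ i := by rw [e1, map_mul, hB3 a ha, mul_one, map_pow]
    have vb : B.valuation (y - z) = B.valuation θ ^ j := by rw [e2, map_mul, hB3 b hb, mul_one, map_pow]
    have ha0 : (a : ℝ) ≠ 0 := by
      have : a ≠ 0 := by rintro rfl; exact ha (dvd_zero _)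
      exact_mod_cast this
    have hb0 : (b : ℝ) ≠ 0 := by
      have : b ≠ 0 := by rintro rfl; exact hb (dvd_zero _)
      exact_mod_cast this
    by_cases hij : i = j
    · exact ⟨1, by simp [hij]⟩
    by_cases hxz : x = z
    · refine ⟨-b / a, ?_⟩
      push_cast
      field_simp
      have : θ ^ i * a + θ ^ j * b = 0 := by rw [← e1, ← e2, hxz]; ring
      linarith
    · obtain ⟨k, c, hc, e3⟩ := H1 x hx z hz hxz
      have vc : B.valuation (x - z) = B.valuation θ ^ k := by rw [e3, map_mul, hB3 c hc, mul_one, map_pow]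
      have vne : B.valuation (x - y) ≠ B.valuation (y - z) := by
        rw [va, vb]; exact fun h => hij (hinj h)
      have hs : x - z = (x - y) + (y - z) := by ring
      rcases lt_or_gt_of_ne vne with hlt | hlt
      · have := Valuation.map_add_eq_of_lt_right _ hlt
        rw [← hs, vc, vb] at this
        have hkj : k = j := hinj this
        subst hkj
        refine ⟨(c - b) / a, ?_⟩
        push_cast
        rw [div_mul_eq_mul_div, eq_div_iff ha0]
        linarith
      · have := Valuation.map_add_eq_of_lt_left _ hlt
        rw [← hs, vc, va] at this
        have hkj : k = i := hinj this
        subst hkj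
        have hne : (c : ℝ) - a ≠ 0 := by
          intro h0
          have : θ ^ j * b = θ ^ k * (c - a) := by linarith
          rw [h0, mul_zero] at this
          exact (mul_ne_zero (pow_ne_zero _ hθ0.ne') hb0) this
        refine ⟨b / (c - a), ?_⟩
        push_cast
        rw [div_mul_eq_mul_div, eq_div_iff hne]
        linarith

lemma combo {p : ℕ} (hp : p.Prime) (θ : ℝ) (hθ : 1 < θ) (T : Set ℝ)
    (H1 : ∀ x ∈ T, ∀ y ∈ T, x ≠ y → ∃ n, 1 ≤ n ∧ Lv p θ n x y)
    (H2 : ∀ k, 1 ≤ k → ∃ x ∈ T, ∃ y ∈ T, Lv p θ k x y) :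
    ∃ A B : ℕ, 0 < B ∧ Nat.Coprime A B ∧ θ = (A : ℝ) / B ∧ p ∣ A ∧
      ∀ x ∈ T, ∀ y ∈ T, ∃ t : ℤ, x - y = θ * t := by
  have hθ0 : 0 < θ := by linarith
  have H1' : ∀ x ∈ T, ∀ y ∈ T, x ≠ y → ∃ n, Lv p θ n x y := fun x hx y hy h => by
    obtain ⟨n, _, hn⟩ := H1 x hx y hy h
    exact ⟨n, hn⟩
  obtain ⟨V, hB1, hB2, hB3⟩ := exists_val hp
  obtain ⟨w, hw⟩ : ∃ w, w = V.valuation θ := ⟨_, rfl⟩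
  have hw0 : 0 < w := by
    rw [hw, Valuation.pos_iff]; exact hθ0.ne'
  have vLv : ∀ {n x y}, Lv p θ n x y → V.valuation (x - y) = w ^ n := by
    rintro n x y ⟨a, ha, e1⟩
    rw [e1, map_mul, hB3 a ha, mul_one, map_pow, hw]
  obtain ⟨x, hx, y, hy, h1⟩ := H2 1 le_rfl
  have hfrac : Function.Injective (fun n : ℕ => w ^ n) → ∃ A B : ℕ, 0 < B ∧ Nat.Coprime A B ∧ θ = (A : ℝ) / B := by
    intro hinj
    obtain ⟨q, hq⟩ := rat_of_val θ hθ T H1' H2 V hB3 (by rw [← hw]; exact hinj)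
    have hq0 : 0 < q := by rw [hq] at hθ0; exact_mod_cast hθ0
    refine ⟨q.num.natAbs, q.den, q.den_pos, q.reduced, ?_⟩
    have : ((q.num.natAbs : ℕ) : ℤ) = q.num := Int.natAbs_of_nonneg (Rat.num_nonneg.mpr hq0.le)
    have h2 : ((q.num.natAbs : ℕ) : ℝ) = (q.num : ℝ) := by rw [← Int.cast_natCast, this]
    rw [hq, h2]
    exact_mod_cast (Rat.num_div_den q).symm
  rcases lt_trichotomy w 1 with hlt | heq | hgt
  · have hmono : ∀ {i j : ℕ}, i < j → w ^ j < w ^ i := fun h => pow_lt_pow_right_of_lt_one₀ hw0 hlt h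
    have hinj : Function.Injective (fun n : ℕ => w ^ n) := by
      intro i j hij
      by_contra hne
      rcases lt_or_gt_of_ne hne with h | h
      · exact absurd hij (hmono h).ne'
      · exact absurd hij (hmono h).ne
    obtain ⟨A, B, hB, hcop, hAB⟩ := hfrac hinj
    have hBr : (B : ℝ) ≠ 0 := by exact_mod_cast hB.ne'
    refine ⟨A, B, hB, hcop, hAB, ?_, ?_⟩
    · by_contra hnd
      have h3 := hB3 (A : ℤ) (by exact_mod_cast hnd)
      have h4 := hB2 (B : ℤ)
      have h5 : ((A : ℤ) : ℝ) = θ * ((B : ℤ) : ℝ) := by rw [hAB]; push_cast; field_simp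
      rw [h5, map_mul, ← hw] at h3
      have : w * V.valuation ((B : ℤ) : ℝ) < 1 := mul_lt_one_of_nonneg_of_lt_one_left zero_le hlt h4
      exact this.ne h3
    · have key : ∀ z ∈ T, ∃ t : ℤ, x - z = θ * t := by
        intro z hz
        by_cases hxz : x = z
        · exact ⟨0, by simp [hxz]⟩
        obtain ⟨n, hn1, hn⟩ := H1 x hx z hz hxz
        by_cases hn2 : n = 1
        · subst hn2
          obtain ⟨u, _, hu⟩ := hn
          exact ⟨u, by simpa using hu⟩
        · have hyz : y ≠ z := by
            rintro rfl
            have := hinj ((vLv h1).symm.trans (vLv hn)); omega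
          obtain ⟨k, _, hk⟩ := H1 y hy z hz hyz
          have hl : V.valuation (x - z) < V.valuation (x - y) := by
            rw [vLv hn, vLv h1]; exact hmono (by omega)
          have := Valuation.map_sub_eq_of_lt_right _ hl
          rw [show x - z - (x - y) = y - z by ring, vLv hk, vLv h1] at this
          have hk1 : k = 1 := hinj this
          subst hk1
          obtain ⟨u, _, hu⟩ := hk
          obtain ⟨u', _, hu'⟩ := h1
          exact ⟨u + u', by push_cast; linarith⟩
      intro z hz z' hz'
      obtain ⟨t, ht⟩ := key z hz
      obtain ⟨t', ht'⟩ := key z' hz'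
      exact ⟨t' - t, by push_cast; linarith⟩
  · exact (val_one_absurd hp θ hθ T H1' H2 V hB1 hB2 hB3 (by rw [← hw, heq])).elim
  · exfalso
    have hmono : ∀ {i j : ℕ}, i < j → w ^ i < w ^ j := fun h => pow_lt_pow_right₀ hgt h
    have hinj : Function.Injective (fun n : ℕ => w ^ n) := by
      intro i j hij
      by_contra hne
      rcases lt_or_gt_of_ne hne with h | h
      · exact absurd hij (hmono h).ne
      · exact absurd hij (hmono h).ne'
    obtain ⟨A, B, hB, hcop, hAB⟩ := hfrac hinj
    have hBr : (B : ℝ) ≠ 0 := by exact_mod_cast hB.ne'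
    have hA2 : 2 ≤ A := by
      rw [hAB, one_lt_div (by exact_mod_cast hB)] at hθ
      have : B < A := by exact_mod_cast hθ
      omega
    have h1' := h1
    obtain ⟨u0, hu0, e0⟩ := h1
    obtain ⟨N, hN⟩ : ∃ N, N = u0.natAbs + 2 := ⟨_, rfl⟩
    obtain ⟨z, n, hz, hxz, hn, hnN⟩ : ∃ z n, z ∈ T ∧ x ≠ z ∧ Lv p θ n x z ∧ N ≤ n := by
      obtain ⟨z, hz, z', hz', hzz⟩ := H2 N (by omega)
      by_cases hxz : x = z
      · subst hxz
        exact ⟨z', N, hz', Lv_ne hθ0.ne' hzz, hzz, le_rfl⟩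
      by_cases hxz' : x = z'
      · subst hxz'
        exact ⟨z, N, hz, hxz, Lv_symm hzz, le_rfl⟩
      obtain ⟨i, _, hi⟩ := H1 x hx z hz hxz
      obtain ⟨j, _, hj⟩ := H1 x hx z' hz' hxz'
      by_contra hno
      push Not at hno
      have hi2 := hno z i hz hxz hi
      have hj2 := hno z' j hz' hxz' hj
      have : V.valuation (z - z') < w ^ N := by
        rw [show z - z' = (x - z') - (x - z) by ring]
        apply lt_of_le_of_lt (Valuation.map_sub _ _ _)
        rw [vLv hi, vLv hj, max_lt_iff]
        exact ⟨hmono hj2, hmono hi2⟩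
      rw [vLv hzz] at this
      exact lt_irrefl _ this
    have hyz : y ≠ z := by
      rintro rfl
      have := hinj ((vLv h1').symm.trans (vLv hn)); omega
    obtain ⟨k, _, hk⟩ := H1 y hy z hz hyz
    have hl : V.valuation (x - y) < V.valuation (x - z) := by
      rw [vLv hn, vLv h1']; exact hmono (by omega)
    have := Valuation.map_sub_eq_of_lt_left _ hl
    rw [show x - z - (x - y) = y - z by ring, vLv hk, vLv hn] at this
    have hk1 : k = n := hinj this
    subst hk1
    obtain ⟨a, _, ea⟩ := hn
    obtain ⟨b, _, eb⟩ := hk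
    obtain ⟨r, rfl⟩ : ∃ r, k = r + 1 := ⟨k - 1, by omega⟩
    have e1 : θ ^ r * (a - b) = u0 := by
      have : θ * (θ ^ r * (a - b)) = θ * u0 := by
        rw [pow_succ] at ea eb; linarith
      exact mul_left_cancel₀ hθ0.ne' this
    rw [hAB, div_pow, div_mul_eq_mul_div, div_eq_iff (pow_ne_zero _ hBr)] at e1
    have e2 : (A : ℤ) ^ r * (a - b) = u0 * (B : ℤ) ^ r := by exact_mod_cast e1
    have e3 : (A : ℤ) ^ r ∣ u0 := by
      have hc : IsCoprime ((A : ℤ) ^ r) ((B : ℤ) ^ r) := (Nat.isCoprime_iff_coprime.mpr hcop).pow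
      exact hc.dvd_of_dvd_mul_right ⟨_, e2.symm⟩
    have hu00 : u0 ≠ 0 := by rintro rfl; exact hu0 (dvd_zero _)
    have e4 : A ^ r ≤ u0.natAbs := by
      apply Nat.le_of_dvd (Int.natAbs_pos.mpr hu00)
      have := Int.natAbs_dvd_natAbs.mpr e3
      rwa [Int.natAbs_pow, Int.natAbs_natCast] at this
    have e5 : r < A ^ r := Nat.lt_pow_self (by omega)
    omega

lemma norm_one_add_exp (t : ℝ) : ‖1 + Complex.exp ((-2 * Real.pi * Complex.I) * (t : ℂ))‖ ^ 2
    = 2 + 2 * Real.cos (2 * Real.pi * t) := by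
  have e : (-2 * (Real.pi : ℂ) * Complex.I) * (t : ℂ) = ((-(2 * Real.pi * t) : ℝ) : ℂ) * Complex.I := by
    push_cast; ring
  rw [e, Complex.exp_mul_I, ← Complex.normSq_eq_norm_sq, Complex.normSq_apply,
    ← Complex.ofReal_cos, ← Complex.ofReal_sin, Real.cos_neg, Real.sin_neg]
  generalize hx : 2 * Real.pi * t = x
  simp only [Complex.add_re, Complex.add_im, Complex.one_re, Complex.one_im, Complex.mul_re, Complex.mul_im,
    Complex.ofReal_re, Complex.ofReal_im, Complex.I_re, Complex.I_im]
  nlinarith [Real.sin_sq_add_cos_sq x]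

lemma cos_bound (ε t : ℝ) (hε : 0 < ε) (h : ∀ z : ℤ, ε ≤ |t - z|) :
    Real.cos (2 * Real.pi * t) ≤ Real.cos (2 * Real.pi * ε) := by
  have h1 := h (round t)
  have h2 := abs_sub_round t
  have e : Real.cos (2 * Real.pi * t) = Real.cos (2 * Real.pi * |t - round t|) := by
    have : Real.cos (2 * Real.pi * |t - round t|) = Real.cos (2 * Real.pi * (t - round t)) := by
      rcases abs_choice (t - round t) with h | h <;> rw [h]
      rw [mul_neg, Real.cos_neg]
    rw [this, show 2 * Real.pi * (t - round t) = 2 * Real.pi * t - (round t : ℤ) * (2 * Real.pi) by ring,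
      Real.cos_sub_int_mul_two_pi]
  rw [e]
  apply Real.cos_le_cos_of_nonneg_of_le_pi
  · have := Real.pi_pos; positivity
  · have := Real.pi_pos; nlinarith
  · have := Real.pi_pos; gcongr

lemma mask_q {p : ℕ} (hp : p.Prime) (D : Fin p → (Fin 2 → ℤ)) (hD0 : D ⟨0, hp.pos⟩ = 0)
    (hD11 : D ⟨1, hp.one_lt⟩ 1 = 0) (ε : ℝ) (hε : 0 < ε) (hε2 : ε ≤ 1 / 2) :
    ∃ q : ℝ, 0 ≤ q ∧ q < 1 ∧ ∀ ζ : Fin 2 → ℝ, (∀ z : ℤ, ε ≤ |(D ⟨1, hp.one_lt⟩ 0 : ℝ) * ζ 0 - z|) →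
      ‖mask (digitR D) ζ‖ ≤ q := by
  have hp2 : (2 : ℝ) ≤ p := by exact_mod_cast hp.two_le
  have hpi := Real.pi_pos
  have hcos : Real.cos (2 * Real.pi * ε) < 1 := by
    rw [← Real.cos_zero]
    apply Real.cos_lt_cos_of_nonneg_of_le_pi le_rfl (by nlinarith) (by positivity)
  have hsq : √(2 + 2 * Real.cos (2 * Real.pi * ε)) < 2 := by
    rw [Real.sqrt_lt' (by norm_num)]; nlinarith
  refine ⟨(p - 2 + √(2 + 2 * Real.cos (2 * Real.pi * ε))) / p, ?_, ?_, ?_⟩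
  · have := Real.sqrt_nonneg (2 + 2 * Real.cos (2 * Real.pi * ε))
    apply div_nonneg <;> linarith
  · rw [div_lt_one (by linarith)]; linarith
  · intro ζ hζ
    unfold mask
    set i0 : Fin p := ⟨0, hp.pos⟩ with hi0
    set i1 : Fin p := ⟨1, hp.one_lt⟩ with hi1
    have hne : i0 ≠ i1 := by simp [hi0, hi1]
    have hsplit : ∑ i : Fin p, expChar ζ (digitR D i) = (expChar ζ (digitR D i0) + expChar ζ (digitR D i1))
        + ∑ i ∈ (Finset.univ \ {i0, i1}), expChar ζ (digitR D i) := by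
      rw [← Finset.sum_pair (f := fun i => expChar ζ (digitR D i)) hne, add_comm, Finset.sum_sdiff (Finset.subset_univ _)]
    have hcard : ((Finset.univ \ {i0, i1} : Finset (Fin p)).card : ℝ) = p - 2 := by
      rw [Finset.card_sdiff_of_subset (Finset.subset_univ _), Finset.card_pair hne, Finset.card_univ, Fintype.card_fin,
        Nat.cast_sub hp.two_le]; simp
    have hrest : ‖∑ i ∈ (Finset.univ \ {i0, i1}), expChar ζ (digitR D i)‖ ≤ p - 2 := by
      rw [← hcard]
      refine (norm_sum_le _ _).trans ?_
      simp [expChar_norm]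
    have e0 : expChar ζ (digitR D i0) = 1 := by
      have : digitR D i0 = 0 := by ext j; simp [digitR, hD0]
      rw [this, expChar_zero_right]
    have e1 : expChar ζ (digitR D i1)
        = Complex.exp ((-2 * Real.pi * Complex.I) * (((D i1 0 : ℝ) * ζ 0 : ℝ) : ℂ)) := by
      simp [expChar, digitR, hD11]; ring_nf
    have hmain : ‖expChar ζ (digitR D i0) + expChar ζ (digitR D i1)‖ ≤ √(2 + 2 * Real.cos (2 * Real.pi * ε)) := by
      apply Real.le_sqrt_of_sq_le
      rw [e0, e1, norm_one_add_exp]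
      have := cos_bound ε _ hε hζ
      linarith
    rw [hsplit, norm_mul, norm_inv, Complex.norm_natCast, inv_mul_eq_div]
    gcongr
    refine (norm_add_le _ _).trans ?_
    linarith

lemma mask_lt {p : ℕ} (hp : p.Prime) (D : Fin p → (Fin 2 → ℤ)) (hD0 : D ⟨0, hp.pos⟩ = 0)
    (hD11 : D ⟨1, hp.one_lt⟩ 1 = 0) (ζ : Fin 2 → ℝ)
    (h : ∀ z : ℤ, (D ⟨1, hp.one_lt⟩ 0 : ℝ) * ζ 0 ≠ z) : ‖mask (digitR D) ζ‖ < 1 := by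
  set t := (D ⟨1, hp.one_lt⟩ 0 : ℝ) * ζ 0 with ht
  obtain ⟨q, _, hq1, hq⟩ := mask_q hp D hD0 hD11 |t - round t| (abs_pos.mpr (sub_ne_zero.mpr (h _)))
    (abs_sub_round t)
  exact lt_of_le_of_lt (hq ζ (fun z => by rw [← ht]; exact round_le t z)) hq1

lemma Pp_norm_le_one (m : (Fin 2 → ℝ) → ℂ) (hm : ∀ ζ, ‖m ζ‖ ≤ 1) (R : (Fin 2 → ℝ) → (Fin 2 → ℝ))
    (n : ℕ) (ξ : Fin 2 → ℝ) : ‖Pp m R n ξ‖ ≤ 1 := by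
  unfold Pp
  rw [norm_prod]
  exact Finset.prod_le_one (fun _ _ => norm_nonneg _) (fun _ _ => hm _)

lemma Pp_norm_le (m : (Fin 2 → ℝ) → ℂ) (hm : ∀ ζ, ‖m ζ‖ ≤ 1) (R : (Fin 2 → ℝ) → (Fin 2 → ℝ))
    (n i : ℕ) (hi : i < n) (ξ : Fin 2 → ℝ) : ‖Pp m R n ξ‖ ≤ ‖m (R^[i + 1] ξ)‖ := by
  unfold Pp
  rw [norm_prod, ← Finset.mul_prod_erase _ _ (Finset.mem_range.mpr hi)]
  exact mul_le_of_le_one_right (norm_nonneg _)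
    (Finset.prod_le_one (fun _ _ => norm_nonneg _) (fun _ _ => hm _))

lemma F_lt {p : ℕ} (hp : p.Prime) (ρ₁ ρ₂ c : ℝ) (h10 : 0 < ρ₁) (h11 : ρ₁ < 1)
    (D : Fin p → (Fin 2 → ℤ)) (hD0 : D ⟨0, hp.pos⟩ = 0)
    (hD11 : D ⟨1, hp.one_lt⟩ 1 = 0) (hD10 : D ⟨1, hp.one_lt⟩ 0 ≠ 0) (F : (Fin 2 → ℝ) → ℂ)
    (hF1 : ∀ ξ, ‖F ξ‖ ≤ 1)
    (hF : ∀ ξ, F ξ = mask (digitR D) (Rmap ρ₁ ρ₂ c ξ) * F (Rmap ρ₁ ρ₂ c ξ)) (η : Fin 2 → ℝ) (hη : η 0 ≠ 0) :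
    ‖F η‖ < 1 := by
  set d : ℝ := (D ⟨1, hp.one_lt⟩ 0 : ℝ) with hd
  have hd0 : d ≠ 0 := by rw [hd]; exact_mod_cast hD10
  have t : Filter.Tendsto (fun n => |d * (ρ₁ ^ n * η 0)|) Filter.atTop (nhds 0) := by
    have := ((tendsto_pow_atTop_nhds_zero_of_lt_one h10.le h11).mul_const (η 0)).const_mul d
    simpa using this.abs
  have t2 := (Filter.tendsto_add_atTop_iff_nat 1).mpr t
  obtain ⟨n, hn⟩ := (t2.eventually (gt_mem_nhds (show (0:ℝ) < 1 by norm_num))).exists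
  have h3 : ‖mask (digitR D) ((Rmap ρ₁ ρ₂ c)^[n + 1] η)‖ < 1 := by
    apply mask_lt hp D hD0 hD11
    intro z hz
    rw [Rmap_iter_zero_coord, ← hd] at hz
    rw [hz] at hn
    have hz0 : z = 0 := Int.abs_lt_one_iff.mp (by exact_mod_cast hn)
    rw [hz0, Int.cast_zero] at hz
    exact (mul_ne_zero hd0 (mul_ne_zero (pow_ne_zero _ h10.ne') hη)) hz
  rw [ft_iter F _ _ hF (n + 1), norm_mul]
  calc _ ≤ ‖mask (digitR D) ((Rmap ρ₁ ρ₂ c)^[n + 1] η)‖ * 1 := by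
        gcongr
        · exact Pp_norm_le _ (mask_norm_le hp.ne_zero _) _ _ _ (by omega) _
        · exact hF1 _
    _ < 1 := by linarith

lemma drop {p : ℕ} (hp : p.Prime) (ρ₁ ρ₂ c : ℝ)
    (h10 : 0 < ρ₁) (h11 : ρ₁ < 1) (h20 : 0 < ρ₂) (h21 : ρ₂ < 1) (hρ : ρ₁ ≠ ρ₂)
    (D : Fin p → (Fin 2 → ℤ)) (hD0 : D ⟨0, hp.pos⟩ = 0)
    (hD11 : D ⟨1, hp.one_lt⟩ 1 = 0) (hD10 : D ⟨1, hp.one_lt⟩ 0 ≠ 0)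
    (μ : Measure (Fin 2 → ℝ)) [IsProbabilityMeasure μ]
    (hF : ∀ ξ, ftMeasure μ ξ = mask (digitR D) (Rmap ρ₁ ρ₂ c ξ) * ftMeasure μ (Rmap ρ₁ ρ₂ c ξ))
    (S : Set (Fin 2 → ℝ)) (hS : S.Countable) (ho : IsOrthoSet μ S)
    (hsum : ∀ ξ, HasSum (fun l : S => ‖ftMeasure μ (ξ - l)‖ ^ 2) 1) (k : ℕ) :
    ∃ x ∈ S, ∃ y ∈ S, x ≠ y ∧ mask (digitR D) ((Rmap ρ₁ ρ₂ c)^[k + 1] (x - y)) = 0 := by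
  by_contra hno
  push Not at hno
  set d : ℝ := (D ⟨1, hp.one_lt⟩ 0 : ℝ) with hd
  have hd0 : d ≠ 0 := by rw [hd]; exact_mod_cast hD10
  have hlev : ∀ x ∈ S, ∀ y ∈ S, x ≠ y → ∃ n, n ≠ k ∧ mask (digitR D) ((Rmap ρ₁ ρ₂ c)^[n + 1] (x - y)) = 0 := by
    intro x hx y hy hxy
    obtain ⟨n, hn⟩ := mask_of_ft_zero _ _ _ hF (ft_cont μ) (ft_zero μ)
      (Rmap_iter_tendsto ρ₁ ρ₂ c h10 h11 h20 h21 hρ) _ (ho x hx y hy hxy)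
    refine ⟨n, ?_, hn⟩
    rintro rfl
    exact hno x hx y hy hxy hn
  have hpm : IsProbabilityMeasure (μ.map (fun x => (Mupper ρ₁ ρ₂ c)⁻¹.mulVec (x + 0))) :=
    Measure.isProbabilityMeasure_map (phi_cont _ _).measurable.aemeasurable
  obtain ⟨ν, hν, hνF⟩ := exists_partial hp.ne_zero ρ₁ ρ₂ c h10.ne' h20.ne' (digitR D)
    (μ.map (fun x => (Mupper ρ₁ ρ₂ c)⁻¹.mulVec (x + 0))) k
  simp only [ft_map c h10.ne' h20.ne'] at hνF
  have hνF2 : ∀ ξ, ftMeasure μ ξ = mask (digitR D) ((Rmap ρ₁ ρ₂ c)^[k + 1] ξ) * ftMeasure ν ξ := by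
    intro ξ
    rw [hνF, ft_iter _ _ _ hF k, hF ((Rmap ρ₁ ρ₂ c)^[k] ξ), Function.iterate_succ_apply']
    ring
  have hoν : IsOrthoSet ν S := by
    intro x hx y hy hxy
    obtain ⟨n, hnk, hn⟩ := hlev x hx y hy hxy
    rw [hνF]
    rcases lt_or_gt_of_ne hnk with h | h
    · rw [Pp_eq_zero _ _ k n h _ hn, zero_mul]
    · rw [← Function.iterate_succ_apply' (Rmap ρ₁ ρ₂ c) k, ft_zero_of_mask _ _ _ hF (n - (k + 1)), mul_zero]
      rw [← Function.iterate_add_apply]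
      convert hn using 3
      omega
  obtain ⟨r, hr⟩ : ∃ r : ℝ, r ∉ ⋃ l ∈ S, Set.range (fun z : ℤ => l 0 + z / (d * ρ₁ ^ (k + 1))) := by
    have hcount : (⋃ l ∈ S, Set.range (fun z : ℤ => l 0 + z / (d * ρ₁ ^ (k + 1)))).Countable :=
      hS.biUnion (fun l _ => Set.countable_range _)
    by_contra hall
    push Not at hall
    have : (⋃ l ∈ S, Set.range (fun z : ℤ => l 0 + z / (d * ρ₁ ^ (k + 1)))) = Set.univ :=
      Set.eq_univ_of_forall hall
    rw [this] at hcount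
    exact Cardinal.not_countable_real hcount
  have hne : d * ρ₁ ^ (k + 1) ≠ 0 := mul_ne_zero hd0 (pow_ne_zero _ h10.ne')
  set ξ : Fin 2 → ℝ := ![r, 0] with hξ
  have hm : ∀ l : S, ‖mask (digitR D) ((Rmap ρ₁ ρ₂ c)^[k + 1] (ξ - l))‖ < 1 := by
    intro l
    apply mask_lt hp D hD0 hD11
    intro z hz
    rw [Rmap_iter_zero_coord, ← hd] at hz
    apply hr
    simp only [Set.mem_iUnion]
    refine ⟨l, l.2, z, ?_⟩
    simp [hξ] at hz
    simp only
    rw [← hz]; field_simp; ring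
  have hle : ∀ l : S, ‖ftMeasure μ (ξ - l)‖ ^ 2 ≤ ‖ftMeasure ν (ξ - l)‖ ^ 2 := by
    intro l
    rw [hνF2, norm_mul]
    gcongr
    exact mul_le_of_le_one_left (norm_nonneg _) (hm l).le
  obtain ⟨l0, hl0⟩ : ∃ l : S, ftMeasure μ (ξ - l) ≠ 0 := by
    by_contra hall
    push Not at hall
    have := hsum ξ
    simp only [hall] at this
    simp at this
    exact one_ne_zero (this.unique hasSum_zero)
  have hlt : ‖ftMeasure μ (ξ - l0)‖ ^ 2 < ‖ftMeasure ν (ξ - l0)‖ ^ 2 := by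
    have h1 : 0 < ‖ftMeasure ν (ξ - l0)‖ := by
      rw [norm_pos_iff]; intro h; apply hl0; rw [hνF2, h, mul_zero]
    have h2 : ‖ftMeasure μ (ξ - l0)‖ < ‖ftMeasure ν (ξ - l0)‖ := by
      rw [hνF2, norm_mul]
      exact mul_lt_of_lt_one_left h1 (hm l0)
    gcongr
  have hb := bessel_summable ν S hoν ξ
  have := Summable.tsum_lt_tsum hle hlt (hsum ξ).summable hb.1
  rw [(hsum ξ).tsum_eq] at this
  linarith [hb.2]

lemma mask_zero_level {p : ℕ} (hp : p.Prime) {D : Fin p → (Fin 2 → ℤ)} {a : Fin 2 → ℤ}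
    (hZ : ZeroSetCond p D a) (ζ : Fin 2 → ℝ) (h : mask (digitR D) ζ = 0) :
    ∃ u : ℤ, ¬ (p : ℤ) ∣ u ∧ ζ 0 = u / p := by
  have hpi : Prime (p : ℤ) := Nat.prime_iff_prime_int.mp hp
  have hp0 : (p : ℝ) ≠ 0 := by exact_mod_cast hp.ne_zero
  obtain ⟨j, hj1, hj2, k, hk⟩ := (hZ.2 ζ).mp h
  refine ⟨j * a 0 + p * k 0, ?_, ?_⟩
  · intro hd
    have h2 : (p : ℤ) ∣ (j : ℤ) * a 0 := (Int.dvd_add_left (dvd_mul_right _ _)).mp hd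
    rcases hpi.dvd_or_dvd h2 with h3 | h3
    · have := Nat.le_of_dvd (by omega) (Int.natCast_dvd_natCast.mp h3)
      omega
    · exact a_not_dvd hZ 0 h3
  · rw [hk 0]; push_cast; field_simp

lemma nec_struct {p : ℕ} (hp : p.Prime) (ρ₁ ρ₂ c : ℝ)
    (h10 : 0 < ρ₁) (h11 : ρ₁ < 1) (h20 : 0 < ρ₂) (h21 : ρ₂ < 1) (hρ : ρ₁ ≠ ρ₂)
    (D : Fin p → (Fin 2 → ℤ)) (a : Fin 2 → ℤ) (hZ : ZeroSetCond p D a) (hD0 : D ⟨0, hp.pos⟩ = 0)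
    (hD11 : D ⟨1, hp.one_lt⟩ 1 = 0) (hD10 : D ⟨1, hp.one_lt⟩ 0 ≠ 0)
    (μ : Measure (Fin 2 → ℝ)) [IsProbabilityMeasure μ]
    (hF : ∀ ξ, ftMeasure μ ξ = mask (digitR D) (Rmap ρ₁ ρ₂ c ξ) * ftMeasure μ (Rmap ρ₁ ρ₂ c ξ))
    (S : Set (Fin 2 → ℝ)) (hS : S.Countable) (ho : IsOrthoSet μ S)
    (hsum : ∀ ξ, HasSum (fun l : S => ‖ftMeasure μ (ξ - l)‖ ^ 2) 1) :
    ∃ A B : ℕ, 0 < B ∧ Nat.Coprime A B ∧ ρ₁⁻¹ = (A : ℝ) / B ∧ p ∣ A ∧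
      ∀ x ∈ S, ∀ y ∈ S, ∀ n, mask (digitR D) ((Rmap ρ₁ ρ₂ c)^[n + 1] (x - y)) = 0 →
        (A : ℝ) ^ (n + 1) / (B * p) ≤ |x 0 - y 0| := by
  have hp0 : (p : ℝ) ≠ 0 := by exact_mod_cast hp.ne_zero
  have hppos : (0 : ℝ) < p := by exact_mod_cast hp.pos
  have hθ : 1 < ρ₁⁻¹ := (one_lt_inv₀ h10).mpr h11
  have lev : ∀ x y : Fin 2 → ℝ, ∀ n, mask (digitR D) ((Rmap ρ₁ ρ₂ c)^[n + 1] (x - y)) = 0 →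
      Lv p ρ₁⁻¹ (n + 1) (p * x 0) (p * y 0) := by
    intro x y n h
    obtain ⟨u, hu, e⟩ := mask_zero_level hp hZ _ h
    refine ⟨u, hu, ?_⟩
    rw [Rmap_iter_zero_coord] at e
    simp only [Pi.sub_apply] at e
    rw [eq_div_iff hp0] at e
    rw [← e, inv_pow]
    have := pow_ne_zero (n + 1) h10.ne'
    field_simp
  have H1 : ∀ x ∈ ((fun l : Fin 2 → ℝ => (p : ℝ) * l 0) '' S), ∀ y ∈ ((fun l : Fin 2 → ℝ => (p : ℝ) * l 0) '' S),
      x ≠ y → ∃ n, 1 ≤ n ∧ Lv p ρ₁⁻¹ n x y := by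
    rintro _ ⟨x, hx, rfl⟩ _ ⟨y, hy, rfl⟩ hne
    have hxy : x ≠ y := by rintro rfl; exact hne rfl
    obtain ⟨n, hn⟩ := mask_of_ft_zero _ _ _ hF (ft_cont μ) (ft_zero μ)
      (Rmap_iter_tendsto ρ₁ ρ₂ c h10 h11 h20 h21 hρ) _ (ho x hx y hy hxy)
    exact ⟨n + 1, by omega, lev x y n hn⟩
  have H2 : ∀ k, 1 ≤ k → ∃ x ∈ ((fun l : Fin 2 → ℝ => (p : ℝ) * l 0) '' S),
      ∃ y ∈ ((fun l : Fin 2 → ℝ => (p : ℝ) * l 0) '' S), Lv p ρ₁⁻¹ k x y := by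
    intro k hk
    obtain ⟨x, hx, y, hy, _, h⟩ := drop hp ρ₁ ρ₂ c h10 h11 h20 h21 hρ D hD0 hD11 hD10 μ hF S hS ho hsum (k - 1)
    have := lev x y _ h
    rw [show k - 1 + 1 = k by omega] at this
    exact ⟨_, ⟨x, hx, rfl⟩, _, ⟨y, hy, rfl⟩, this⟩
  obtain ⟨A, B, hB, hcop, hAB, hpA, hdiff⟩ := combo hp ρ₁⁻¹ hθ _ H1 H2
  · refine ⟨A, B, hB, hcop, hAB, hpA, ?_⟩
    intro x hx y hy n h
    obtain ⟨u, hu, e⟩ := lev x y n h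
    obtain ⟨t, ht⟩ := hdiff _ ⟨x, hx, rfl⟩ _ ⟨y, hy, rfl⟩
    simp only at ht
    have hBr : (0 : ℝ) < B := by exact_mod_cast hB
    have hA0 : (0 : ℝ) < A := by
      have h0 : 0 < (A : ℝ) / B := by rw [← hAB]; positivity
      by_contra hneg
      have : (A : ℝ) / B ≤ 0 := div_nonpos_of_nonpos_of_nonneg (not_lt.mp hneg) hBr.le
      linarith
    have e1 : (ρ₁⁻¹) ^ n * u = t := by
      have : ρ₁⁻¹ * ((ρ₁⁻¹) ^ n * u) = ρ₁⁻¹ * t := by rw [← ht, e, pow_succ]; ring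
      exact mul_left_cancel₀ (by positivity) this
    rw [hAB, div_pow, div_mul_eq_mul_div, div_eq_iff (pow_ne_zero _ hBr.ne')] at e1
    have e2 : (A : ℤ) ^ n * u = t * (B : ℤ) ^ n := by exact_mod_cast e1
    have e3 : (B : ℤ) ^ n ∣ u := by
      have hc : IsCoprime ((B : ℤ) ^ n) ((A : ℤ) ^ n) := (Nat.isCoprime_iff_coprime.mpr hcop.symm).pow
      exact hc.dvd_of_dvd_mul_left ⟨t, by rw [e2]; ring⟩
    have hu0 : u ≠ 0 := by rintro rfl; exact hu (dvd_zero _)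
    have e4 : (B : ℤ) ^ n ≤ |u| := Int.le_of_dvd (abs_pos.mpr hu0) ((dvd_abs _ _).mpr e3)
    have e5 : (B : ℝ) ^ n ≤ |(u : ℝ)| := by exact_mod_cast e4
    have e6 : (p : ℝ) * |x 0 - y 0| = (A : ℝ) ^ (n + 1) / B ^ (n + 1) * |(u : ℝ)| := by
      have e7 : (p : ℝ) * |x 0 - y 0| = |p * x 0 - p * y 0| := by
        rw [← mul_sub, abs_mul, abs_of_pos hppos]
      rw [e7, e, hAB, abs_mul, div_pow, abs_of_pos (by positivity)]
    rw [div_le_iff₀ (by positivity)]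
    calc (A : ℝ) ^ (n + 1) = (A : ℝ) ^ (n + 1) / B ^ (n + 1) * B ^ n * B := by
          rw [pow_succ (B : ℝ)]; field_simp
      _ ≤ (A : ℝ) ^ (n + 1) / B ^ (n + 1) * |(u : ℝ)| * B := by gcongr
      _ = |x 0 - y 0| * (B * p) := by rw [← e6]; ring

/-- Erdős–Kahane type argument. -/
lemma decay_core (A B s p : ℕ) (hB : 2 ≤ B) (hBA : B < A) (hs : A ≤ B ^ s) (hcop : Nat.Coprime A B)
    (hp : 1 ≤ p) (d : ℤ) (hd : d ≠ 0) :
    ∃ j0 : ℕ, 1 ≤ j0 ∧ ∀ j, j0 ≤ j → ∀ x : ℝ, (B : ℝ) ^ ((1 + 4 * s) * j) / (2 * p) ≤ |x| →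
      ∃ i : ℕ, (B : ℝ) ^ j / (2 * p) ≤ |((B : ℝ) / A) ^ (i + 1) * x| ∧
        ∀ z : ℤ, 1 / (2 * ((A : ℝ) + B)) ≤ |(d : ℝ) * (((B : ℝ) / A) ^ (i + 1) * x) - z| := by
  have hBr : (2 : ℝ) ≤ B := by exact_mod_cast hB
  have hBAr : (B : ℝ) < A := by exact_mod_cast hBA
  have hA0 : (0 : ℝ) < A := by linarith
  have hpr : (1 : ℝ) ≤ p := by exact_mod_cast hp
  have hd1 : (1 : ℝ) ≤ |(d : ℝ)| := by exact_mod_cast Int.one_le_abs hd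
  obtain ⟨Q, hQ⟩ := exists_nat_gt (1 + |(d : ℝ)| * A)
  refine ⟨max (4 * p) Q + 1, by omega, ?_⟩
  intro j hj x hx
  have hjp : 4 * p ≤ j := by omega
  have hjQ : Q ≤ j := by omega
  set ρ : ℝ := (B : ℝ) / A with hρ
  have hρ0 : 0 < ρ := by positivity
  have hρ1 : ρ < 1 := by rw [hρ, div_lt_one hA0]; exact hBAr
  have hjB : (j : ℝ) < (B : ℝ) ^ j := by exact_mod_cast Nat.lt_pow_self (by omega)
  have hbd : (2 : ℝ) < (B : ℝ) ^ j / (2 * p) := by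
    rw [lt_div_iff₀ (by positivity)]
    have : (4 * p : ℝ) ≤ j := by exact_mod_cast hjp
    linarith
  have hex : ∃ k : ℕ, ρ ^ (k + 1) * |x| < (B : ℝ) ^ j / (2 * p) := by
    have t : Filter.Tendsto (fun n => ρ ^ n * |x|) Filter.atTop (nhds 0) := by
      have := ((tendsto_pow_atTop_nhds_zero_of_lt_one hρ0.le hρ1).mul_const |x|)
      simpa using this
    have t2 := (Filter.tendsto_add_atTop_iff_nat 1).mpr t
    exact (t2.eventually (gt_mem_nhds (show (0:ℝ) < (B : ℝ) ^ j / (2 * p) by linarith))).exists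
  classical
  obtain ⟨k, hkdef⟩ : ∃ k, k = Nat.find hex := ⟨_, rfl⟩
  have hk : ρ ^ (k + 1) * |x| < (B : ℝ) ^ j / (2 * p) := by rw [hkdef]; exact Nat.find_spec hex
  have hkmin : ∀ i, i < k → (B : ℝ) ^ j / (2 * p) ≤ ρ ^ (i + 1) * |x| := by
    intro i hi
    rw [hkdef] at hi
    exact not_lt.mp (Nat.find_min hex hi)
  -- k large
  have hklarge : 4 * j < k + 1 := by
    have h1 : ρ ^ (k + 1) * (B : ℝ) ^ ((1 + 4 * s) * j) < (B : ℝ) ^ j := by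
      have := mul_le_mul_of_nonneg_left hx (show 0 ≤ ρ ^ (k + 1) by positivity)
      have h2 := lt_of_le_of_lt this hk
      rw [← mul_div_assoc] at h2
      exact (div_lt_div_iff_of_pos_right (by positivity)).mp h2
    have h3 : (B : ℝ) ^ (k + 1) * (B : ℝ) ^ ((1 + 4 * s) * j) < (B : ℝ) ^ j * (A : ℝ) ^ (k + 1) := by
      rw [hρ, div_pow, div_mul_eq_mul_div, div_lt_iff₀ (by positivity)] at h1
      exact h1
    have h4 : (A : ℝ) ^ (k + 1) ≤ (B : ℝ) ^ (s * (k + 1)) := by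
      rw [pow_mul]
      gcongr
      exact_mod_cast hs
    have h5 : (B : ℝ) ^ (k + 1 + (1 + 4 * s) * j) < (B : ℝ) ^ (j + s * (k + 1)) := by
      rw [pow_add (B : ℝ) (k + 1), pow_add (B : ℝ) j]
      refine h3.trans_le ?_
      gcongr
    have h6 := (pow_lt_pow_iff_right₀ (show (1:ℝ) < B by linarith)).mp h5
    by_contra hcon
    have h7 : k + 1 ≤ 4 * j := by omega
    have h8 : s * (k + 1) ≤ s * (4 * j) := Nat.mul_le_mul_left s h7
    have : (1 + 4 * s) * j = j + s * (4 * j) := by ring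
    omega
  by_contra hno
  push Not at hno
  have hclose : ∀ i, i < k → ∃ z : ℤ, |(d : ℝ) * (ρ ^ (i + 1) * x) - z| < 1 / (2 * ((A : ℝ) + B)) := by
    intro i hi
    apply hno
    rw [abs_mul, abs_of_pos (show 0 < ρ ^ (i + 1) by positivity)]
    exact hkmin i hi
  choose! z hz using hclose
  have hstep : ∀ i, i + 1 < k → (A : ℤ) * z (i + 1) = B * z i := by
    intro i hi
    have e1 := hz i (by omega)
    have e2 := hz (i + 1) hi
    have e3 : (A : ℝ) * ((d : ℝ) * (ρ ^ (i + 1 + 1) * x)) = B * ((d : ℝ) * (ρ ^ (i + 1) * x)) := by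
      have : (A : ℝ) * ρ = B := by rw [hρ]; field_simp
      rw [pow_succ ρ (i + 1), ← this]; ring
    have hlt : |((A : ℤ) * z (i + 1) - B * z i : ℤ)| < (1 : ℤ) := by
      have : |((((A : ℤ) * z (i + 1) - B * z i : ℤ)) : ℝ)| < 1 := by
        push_cast
        have e4 : (A : ℝ) * z (i + 1) - B * z i = B * ((d : ℝ) * (ρ ^ (i + 1) * x) - z i)
            - A * ((d : ℝ) * (ρ ^ (i + 1 + 1) * x) - z (i + 1)) := by linear_combination e3
        rw [e4]
        calc _ ≤ |B * ((d : ℝ) * (ρ ^ (i + 1) * x) - z i)| + |A * ((d : ℝ) * (ρ ^ (i + 1 + 1) * x) - z (i + 1))| := abs_sub _ _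
          _ = B * |((d : ℝ) * (ρ ^ (i + 1) * x) - z i)| + A * |((d : ℝ) * (ρ ^ (i + 1 + 1) * x) - z (i + 1))| := by
            rw [abs_mul, abs_mul, abs_of_pos hA0, abs_of_pos (show (0:ℝ) < B by linarith)]
          _ ≤ B * (1 / (2 * ((A : ℝ) + B))) + A * (1 / (2 * ((A : ℝ) + B))) := by gcongr
          _ = 1 / 2 := by field_simp; ring
          _ < 1 := by norm_num
      exact_mod_cast this
    have := Int.abs_lt_one_iff.mp hlt
    omega
  have hpow : ∀ i, i < k → (A : ℤ) ^ i * z i = B ^ i * z 0 := by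
    intro i
    induction i with
    | zero => intro _; simp
    | succ i ih =>
      intro hi
      have h1 := hstep i hi
      have h2 := ih (by omega)
      calc (A : ℤ) ^ (i + 1) * z (i + 1) = A ^ i * (A * z (i + 1)) := by ring
        _ = B * (A ^ i * z i) := by rw [h1]; ring
        _ = _ := by rw [h2]; ring
  obtain ⟨r, rfl⟩ : ∃ r, k = r + 1 := ⟨k - 1, by omega⟩
  have h1 := hpow r (by omega)
  have h2 : (B : ℤ) ^ r ∣ z r := by
    have hc : IsCoprime ((B : ℤ) ^ r) ((A : ℤ) ^ r) := (Nat.isCoprime_iff_coprime.mpr hcop.symm).pow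
    exact hc.dvd_of_dvd_mul_left ⟨z 0, h1⟩
  have hzr := hz r (by omega)
  have hlow := hkmin r (by omega)
  have hsmall : 1 / (2 * ((A : ℝ) + B)) ≤ 1 := by
    rw [div_le_one (by positivity)]; linarith
  have habs : |(d : ℝ) * (ρ ^ (r + 1) * x)| = |(d : ℝ)| * (ρ ^ (r + 1) * |x|) := by
    rw [abs_mul, abs_mul, abs_of_pos (show 0 < ρ ^ (r + 1) by positivity)]
  have hz0 : z r ≠ 0 := by
    intro h0
    rw [h0, Int.cast_zero, sub_zero, habs] at hzr
    nlinarith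
  have h3 : (B : ℝ) ^ r ≤ |(z r : ℝ)| := by
    have := Int.le_of_dvd (abs_pos.mpr hz0) ((dvd_abs _ _).mpr h2)
    exact_mod_cast this
  have h4 : |(z r : ℝ)| ≤ |(d : ℝ)| * (ρ ^ (r + 1) * |x|) + 1 := by
    rw [← habs]
    have := abs_sub_abs_le_abs_sub (z r : ℝ) ((d : ℝ) * (ρ ^ (r + 1) * x))
    rw [abs_sub_comm] at this
    linarith
  have h5 : ρ ^ (r + 1) * |x| ≤ A * (B : ℝ) ^ j := by
    have e : ρ ^ (r + 1 + 1) * |x| = ρ * (ρ ^ (r + 1) * |x|) := by ring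
    rw [e, hρ, div_mul_eq_mul_div, div_lt_iff₀ hA0, ← hρ] at hk
    have hX : 0 ≤ ρ ^ (r + 1) * |x| := by positivity
    have h6 : (B : ℝ) ^ j / (2 * p) ≤ (B : ℝ) ^ j := by
      apply div_le_self (by positivity); linarith
    nlinarith
  have h7 : (B : ℝ) ^ (2 * j) ≤ (B : ℝ) ^ r := pow_le_pow_right₀ (by linarith) (by omega)
  have h8 : (B : ℝ) ^ (2 * j) ≤ (1 + |(d : ℝ)| * A) * (B : ℝ) ^ j := by
    have h9 : (1 : ℝ) ≤ (B : ℝ) ^ j := one_le_pow₀ (by linarith)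
    have h10 := mul_le_mul_of_nonneg_left h5 (abs_nonneg (d : ℝ))
    nlinarith
  rw [two_mul, pow_add] at h8
  have h9 := le_of_mul_le_mul_right h8 (by positivity)
  have h10 : (Q : ℝ) ≤ j := by exact_mod_cast hjQ
  linarith

lemma summable_J (ω : ℕ → ℝ) (h0 : ∀ i, 0 ≤ ω i) (J : ℕ) (q : ℝ) (hq : q < 1)
    (h : ∀ i, ω (i + J) ≤ q * ω i) : Summable ω := by
  apply summable_of_sum_range_le (c := (∑ i ∈ Finset.range J, ω i) / (1 - q)) h0
  intro n
  rw [le_div_iff₀ (by linarith)]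
  have h1 : ∑ i ∈ Finset.range n, ω i ≤ ∑ i ∈ Finset.range (J + n), ω i :=
    Finset.sum_le_sum_of_subset_of_nonneg (Finset.range_mono (by omega)) (fun _ _ _ => h0 _)
  rw [Finset.sum_range_add] at h1
  have h2 : ∑ i ∈ Finset.range n, ω (J + i) ≤ q * ∑ i ∈ Finset.range n, ω i := by
    rw [Finset.mul_sum]
    apply Finset.sum_le_sum
    intro i _
    rw [add_comm]; exact h i
  linarith

lemma h_lower (h ω : ℕ → ℝ) (h0 : ∀ i, 0 < h i) (hω : ∀ i, 0 ≤ ω i) (hω1 : ∀ i, ω i ≤ 1) (hs : Summable ω)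
    (hst : ∀ i, (1 - ω i) * h i ≤ h (i + 1)) : ¬ Filter.Tendsto h Filter.atTop (nhds 0) := by
  intro ht
  obtain ⟨i0, hi0⟩ := ((tendsto_sum_nat_add ω).eventually (gt_mem_nhds (show (0:ℝ) < 1 / 2 by norm_num))).exists
  have hs2 : Summable (fun k => ω (k + i0)) := (summable_nat_add_iff i0).mpr hs
  have key : ∀ n, h i0 * (1 - ∑ k ∈ Finset.range n, ω (k + i0)) ≤ h (n + i0) := by
    intro n
    induction n with
    | zero => simp
    | succ n ih =>
      rw [Finset.sum_range_succ]
      have h1 := hst (n + i0)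
      have h2 := hω (n + i0)
      have h3 := hω1 (n + i0)
      have h4 : 0 ≤ ∑ k ∈ Finset.range n, ω (k + i0) := Finset.sum_nonneg (fun _ _ => hω _)
      have h5 := h0 i0
      have e : n + 1 + i0 = n + i0 + 1 := by ring
      rw [e]
      have h6 := mul_le_mul_of_nonneg_left ih (show 0 ≤ 1 - ω (n + i0) by linarith)
      refine le_trans ?_ (h6.trans h1)
      have : 0 ≤ h i0 * (ω (n + i0) * ∑ k ∈ Finset.range n, ω (k + i0)) := by positivity
      nlinarith
  have key2 : ∀ n, h i0 / 2 ≤ h (n + i0) := by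
    intro n
    have h1 := hs2.sum_le_tsum (Finset.range n) (fun _ _ => hω _)
    have h5 := h0 i0
    have := key n
    nlinarith
  have t2 := (Filter.tendsto_add_atTop_iff_nat i0).mpr ht
  have := ge_of_tendsto' t2 key2
  linarith [h0 i0]

lemma dhl {ι : Type*} (f : ι → ℝ) (hf0 : ∀ l, 0 ≤ f l) (hf : HasSum f 1) (V : ℕ → Set ι) (hV : Monotone V)
    (hVex : ∀ l, ∃ n, l ∈ V n) (g : ℕ → ι → ℝ) (hg0 : ∀ n l, 0 ≤ g n l)
    (hg : ∀ n (t : Finset ι), (∀ l ∈ t, l ∈ V n) → ∑ l ∈ t, g n l ≤ 1)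
    (hfg : ∀ n l, f l ≤ g n l) (hlt : ∀ n l, g n l ≠ 0 → f l < g n l)
    (N : ℕ → ℕ) (hN : StrictMono N) (ω : ℕ → ℝ) (hω0 : ∀ i, 0 ≤ ω i) (hω1 : ∀ i, ω i ≤ 1) (hωs : Summable ω)
    (hw : ∀ i l, l ∈ V (N (i + 1)) → l ∉ V (N i) → f l ≤ ω i * g (N (i + 1)) l) : False := by
  classical
  have hgs : ∀ n (t : Finset ι), ∑ l ∈ t, (V n).indicator (g n) l ≤ 1 := by
    intro n t
    have : ∑ l ∈ t, (V n).indicator (g n) l = ∑ l ∈ t.filter (fun l => l ∈ V n), g n l := by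
      rw [Finset.sum_filter]
      exact Finset.sum_congr rfl (fun l _ => by rw [Set.indicator_apply])
    rw [this]
    exact hg n _ (fun l hl => (Finset.mem_filter.mp hl).2)
  have hgi0 : ∀ n l, 0 ≤ (V n).indicator (g n) l := fun n l => Set.indicator_nonneg (fun l _ => hg0 n l) l
  have hfi0 : ∀ n l, 0 ≤ (V n).indicator f l := fun n l => Set.indicator_nonneg (fun l _ => hf0 l) l
  have hgsum : ∀ n, Summable ((V n).indicator (g n)) := fun n => summable_of_sum_le (hgi0 n) (hgs n)
  have hfsum : ∀ n, Summable ((V n).indicator f) := fun n => hf.summable.indicator _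
  have hpos : ∀ n, ∑' l, (V n).indicator f l < 1 := by
    intro n
    by_cases hz : ∀ l, (V n).indicator (g n) l = 0
    · have : ∀ l, (V n).indicator f l = 0 := by
        intro l
        refine le_antisymm ?_ (hfi0 n l)
        rw [← hz l]
        exact Set.indicator_le_indicator (hfg n l)
      simp [this]
    · push Not at hz
      obtain ⟨l, hl⟩ := hz
      have hlV : l ∈ V n := Set.mem_of_indicator_ne_zero hl
      rw [Set.indicator_of_mem hlV] at hl
      refine lt_of_lt_of_le (Summable.tsum_lt_tsum (i := l) (g := (V n).indicator (g n)) ?_ ?_ (hfsum n) (hgsum n))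
        ((hgsum n).tsum_le_of_sum_le (hgs n))
      · intro k; exact Set.indicator_le_indicator (hfg n k)
      · rw [Set.indicator_of_mem hlV, Set.indicator_of_mem hlV]; exact hlt n l hl
  have hstep : ∀ i, ∑' l, (V (N (i + 1))).indicator f l
      ≤ (1 - ω i) * ∑' l, (V (N i)).indicator f l + ω i := by
    intro i
    apply (hfsum _).tsum_le_of_sum_le
    intro t
    have h1 : ∀ l ∈ t, (V (N (i + 1))).indicator f l ≤ (1 - ω i) * (V (N i)).indicator f l
        + ω i * (V (N (i + 1))).indicator (g (N (i + 1))) l := by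
      intro l _
      by_cases hU : l ∈ V (N i)
      · have hU2 : l ∈ V (N (i + 1)) := hV (hN (Nat.lt_succ_self i)).le hU
        rw [Set.indicator_of_mem hU, Set.indicator_of_mem hU2, Set.indicator_of_mem hU2]
        have := mul_le_mul_of_nonneg_left (hfg (N (i + 1)) l) (hω0 i)
        linarith
      · rw [Set.indicator_of_notMem hU]
        by_cases hU2 : l ∈ V (N (i + 1))
        · rw [Set.indicator_of_mem hU2, Set.indicator_of_mem hU2]
          have := hw i l hU2 hU
          linarith
        · rw [Set.indicator_of_notMem hU2, Set.indicator_of_notMem hU2]; simp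
    refine (Finset.sum_le_sum h1).trans ?_
    rw [Finset.sum_add_distrib, ← Finset.mul_sum, ← Finset.mul_sum]
    have h2 := (hfsum (N i)).sum_le_tsum t (fun l _ => hfi0 _ l)
    have h3 := mul_le_mul_of_nonneg_left h2 (sub_nonneg.mpr (hω1 i))
    have h4 := mul_le_mul_of_nonneg_left (hgs (N (i + 1)) t) (hω0 i)
    linarith
  have hlim : Filter.Tendsto (fun i => ∑' l, (V (N i)).indicator f l) Filter.atTop (nhds (∑' l, f l)) := by
    apply tendsto_tsum_of_dominated_convergence (bound := f) hf.summable
    · intro l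
      obtain ⟨n, hn⟩ := hVex l
      apply tendsto_const_nhds.congr'
      filter_upwards [Filter.eventually_ge_atTop n] with i hi
      rw [Set.indicator_of_mem (hV (hi.trans hN.le_apply) hn)]
    · refine Filter.Eventually.of_forall (fun i l => ?_)
      rw [Real.norm_of_nonneg (hfi0 _ l)]
      exact Set.indicator_le_self' (fun _ _ => hf0 _) l
  refine h_lower (fun i => 1 - ∑' l, (V (N i)).indicator f l) ω (fun i => sub_pos.mpr (hpos _)) hω0 hω1 hωs ?_ ?_
  · intro i
    have := hstep i
    nlinarith
  · rw [hf.tsum_eq] at hlim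
    simpa using hlim.const_sub 1

lemma exists_seq (s n0 : ℕ) (hs : 1 ≤ s) (hn0 : s ≤ n0) : ∃ N : ℕ → ℕ, N 0 = n0 ∧ StrictMono N ∧
    (∀ i, N (i + 1) = N i + N i / s) ∧ (∀ k i, 2 ^ k * (N i / s) ≤ N (i + s * k) / s) := by
  have hrec : ∀ i, (fun n => n + n / s)^[i + 1] n0 = (fun n => n + n / s)^[i] n0 + (fun n => n + n / s)^[i] n0 / s := by
    intro i; rw [Function.iterate_succ_apply']
  generalize hN : (fun i => (fun n => n + n / s)^[i] n0) = N
  have h0 : N 0 = n0 := by rw [← hN]; rfl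
  have hr : ∀ i, N (i + 1) = N i + N i / s := by rw [← hN]; exact hrec
  have hm : Monotone N := monotone_nat_of_le_succ (fun i => by rw [hr]; exact Nat.le_add_right _ _)
  have hge : ∀ i, s ≤ N i := fun i => hn0.trans (h0 ▸ hm (Nat.zero_le i))
  refine ⟨N, h0, strictMono_nat_of_lt_succ (fun i => ?_), hr, ?_⟩
  · rw [hr]
    have := Nat.div_pos (hge i) hs
    omega
  · have hadd : ∀ i k, N i + k * (N i / s) ≤ N (i + k) := by
      intro i k
      induction k with
      | zero => simp
      | succ k ih =>
        rw [← add_assoc, hr]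
        have : N i / s ≤ N (i + k) / s := Nat.div_le_div_right (hm (by omega))
        rw [Nat.succ_mul]; omega
    have hdbl : ∀ i, 2 * (N i / s) ≤ N (i + s) / s := by
      intro i
      rw [Nat.le_div_iff_mul_le hs]
      have h1 := hadd i s
      have h2 := Nat.div_mul_le_self (N i) s
      nlinarith
    intro k
    induction k with
    | zero => intro i; simp
    | succ k ih =>
      intro i
      have h1 := ih i
      have h2 := hdbl (i + s * k)
      rw [show i + s * (k + 1) = i + s * k + s by ring, pow_succ]
      nlinarith

lemma exists_Phi {p : ℕ} (hp : p.Prime) (ρ₁ ρ₂ c : ℝ)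
    (D : Fin p → (Fin 2 → ℤ)) (hD0 : D ⟨0, hp.pos⟩ = 0)
    (hD11 : D ⟨1, hp.one_lt⟩ 1 = 0) (hD10 : D ⟨1, hp.one_lt⟩ 0 ≠ 0) (F : (Fin 2 → ℝ) → ℂ)
    (hF1 : ∀ ξ, ‖F ξ‖ ≤ 1)
    (hF : ∀ ξ, F ξ = mask (digitR D) (Rmap ρ₁ ρ₂ c ξ) * F (Rmap ρ₁ ρ₂ c ξ))
    (A B s : ℕ) (hB : 2 ≤ B) (hBA : B < A) (hs : A ≤ B ^ s) (hcop : Nat.Coprime A B)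
    (hAB : ρ₁ = (B : ℝ) / A) :
    ∃ Φ : ℕ → ℝ, (∀ j, 0 ≤ Φ j) ∧ (∀ j, Φ j ≤ 1) ∧ Antitone Φ ∧
      (∀ (j : ℕ) (η : Fin 2 → ℝ), (B : ℝ) ^ j / (2 * p) ≤ |η 0| → ‖F η‖ ≤ Φ j) ∧
      ∃ q : ℝ, 0 ≤ q ∧ q < 1 ∧ ∃ j0, 1 ≤ j0 ∧ ∀ j, j0 ≤ j → Φ ((1 + 4 * s) * j) ≤ q * Φ j := by
  have hBr : (2 : ℝ) ≤ B := by exact_mod_cast hB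
  have hAr : (2 : ℝ) ≤ A := by exact_mod_cast (show 2 ≤ A by omega)
  obtain ⟨j0, hj0, hdec⟩ := decay_core A B s p hB hBA hs hcop hp.one_lt.le (D ⟨1, hp.one_lt⟩ 0) hD10
  obtain ⟨q, hq0, hq1, hq⟩ := mask_q hp D hD0 hD11 (1 / (2 * ((A : ℝ) + B))) (by positivity) (by
    apply one_div_le_one_div_of_le <;> linarith)
  have hpp : (0 : ℝ) < p := by exact_mod_cast hp.pos
  have hbdd : ∀ j : ℕ, BddAbove ((fun η => ‖F η‖) '' {η : Fin 2 → ℝ | (B : ℝ) ^ j / (2 * p) ≤ |η 0|}) := by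
    intro j
    refine ⟨1, ?_⟩
    rintro _ ⟨η, _, rfl⟩; exact hF1 η
  have hne : ∀ j : ℕ, ((fun η => ‖F η‖) '' {η : Fin 2 → ℝ | (B : ℝ) ^ j / (2 * p) ≤ |η 0|}).Nonempty := by
    intro j
    refine ⟨_, ⟨fun _ => (B : ℝ) ^ j / (2 * p), ?_, rfl⟩⟩
    exact le_abs_self ((B : ℝ) ^ j / (2 * p))
  have hle : ∀ (j : ℕ) (η : Fin 2 → ℝ), (B : ℝ) ^ j / (2 * p) ≤ |η 0| →
      ‖F η‖ ≤ sSup ((fun η => ‖F η‖) '' {η : Fin 2 → ℝ | (B : ℝ) ^ j / (2 * p) ≤ |η 0|}) :=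
    fun j η h => le_csSup (hbdd j) ⟨η, h, rfl⟩
  refine ⟨fun j => sSup ((fun η => ‖F η‖) '' {η : Fin 2 → ℝ | (B : ℝ) ^ j / (2 * p) ≤ |η 0|}), ?_, ?_, ?_, hle,
    q, hq0, hq1, j0, hj0, ?_⟩
  · intro j
    apply Real.sSup_nonneg
    rintro _ ⟨η, _, rfl⟩; exact norm_nonneg _
  · intro j
    apply csSup_le (hne j)
    rintro _ ⟨η, _, rfl⟩; exact hF1 η
  · intro i j hij
    apply csSup_le_csSup (hbdd i) (hne j)
    apply Set.image_mono
    intro η (hη : (B : ℝ) ^ j / (2 * p) ≤ |η 0|)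
    refine le_trans ?_ hη
    have : (B : ℝ) ^ i ≤ (B : ℝ) ^ j := pow_le_pow_right₀ (by linarith) hij
    gcongr
  · intro j hj
    apply csSup_le (hne _)
    rintro _ ⟨η, hη, rfl⟩
    obtain ⟨i, hi1, hi2⟩ := hdec j hj (η 0) hη
    have e := ft_iter _ _ _ hF (i + 1) η
    simp only
    rw [e, norm_mul]
    have h1 : ‖Pp (mask (digitR D)) (Rmap ρ₁ ρ₂ c) (i + 1) η‖ ≤ q := by
      refine (Pp_norm_le _ (fun ζ => mask_norm_le hp.ne_zero _ ζ) _ (i + 1) i (by omega) η).trans ?_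
      apply hq
      rw [Rmap_iter_zero_coord, hAB]
      exact hi2
    have h2 := hle j ((Rmap ρ₁ ρ₂ c)^[i + 1] η) (by rw [Rmap_iter_zero_coord, hAB]; exact hi1)
    exact mul_le_mul h1 h2 (norm_nonneg _) hq0

lemma nec_B {p : ℕ} (hp : p.Prime) (ρ₁ ρ₂ c : ℝ)
    (h10 : 0 < ρ₁) (h11 : ρ₁ < 1) (h20 : 0 < ρ₂) (h21 : ρ₂ < 1) (hρ : ρ₁ ≠ ρ₂)
    (D : Fin p → (Fin 2 → ℤ)) (hD0 : D ⟨0, hp.pos⟩ = 0)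
    (hD11 : D ⟨1, hp.one_lt⟩ 1 = 0) (hD10 : D ⟨1, hp.one_lt⟩ 0 ≠ 0)
    (μ : Measure (Fin 2 → ℝ)) [IsProbabilityMeasure μ]
    (hF : ∀ ξ, ftMeasure μ ξ = mask (digitR D) (Rmap ρ₁ ρ₂ c ξ) * ftMeasure μ (Rmap ρ₁ ρ₂ c ξ))
    (S : Set (Fin 2 → ℝ)) (hS : S.Countable) (ho : IsOrthoSet μ S)
    (hsum : ∀ ξ, HasSum (fun l : S => ‖ftMeasure μ (ξ - l)‖ ^ 2) 1)
    (A B : ℕ) (hB : 2 ≤ B) (hcop : Nat.Coprime A B) (hAB : ρ₁⁻¹ = (A : ℝ) / B)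
    (hsep : ∀ x ∈ S, ∀ y ∈ S, ∀ n, mask (digitR D) ((Rmap ρ₁ ρ₂ c)^[n + 1] (x - y)) = 0 →
        (A : ℝ) ^ (n + 1) / (B * p) ≤ |x 0 - y 0|) : False := by
  have hpp : (0 : ℝ) < p := by exact_mod_cast hp.pos
  have hBr : (2 : ℝ) ≤ B := by exact_mod_cast hB
  have hB0 : (0 : ℝ) < B := by linarith
  have hθ : 1 < ρ₁⁻¹ := (one_lt_inv₀ h10).mpr h11
  have hBAr : (B : ℝ) < A := by
    rw [hAB, lt_div_iff₀ hB0] at hθ; linarith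
  have hBA : B < A := by exact_mod_cast hBAr
  have hA0 : (0 : ℝ) < A := by linarith
  have hρAB : ρ₁ = (B : ℝ) / A := by
    rw [← inv_inv ρ₁, hAB, inv_div]
  obtain ⟨s, hs⟩ : ∃ s, A ≤ B ^ s := ⟨A, (Nat.lt_pow_self (by omega)).le⟩
  have hs1 : 1 ≤ s := by
    by_contra h
    have : s = 0 := by omega
    rw [this, pow_zero] at hs
    omega
  have hsr : (A : ℝ) ≤ (B : ℝ) ^ s := by exact_mod_cast hs
  obtain ⟨Φ, hΦ0, hΦ1, hΦa, hΦ, q, hq0, hq1, j0, hj0, hdec⟩ :=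
    exists_Phi hp ρ₁ ρ₂ c D hD0 hD11 hD10 (ftMeasure μ) (ft_norm_le μ) hF A B s hB hBA hs hcop hρAB
  obtain ⟨N, hN0, hNm, hNr, hNd⟩ := exists_seq s (s * j0) hs1 (Nat.le_mul_of_pos_right s hj0)
  have hNa : ∀ i, j0 ≤ N i / s := by
    intro i
    rw [Nat.le_div_iff_mul_le hs1, mul_comm, ← hN0]
    exact hNm.monotone (Nat.zero_le i)
  -- base point
  obtain ⟨r, hr⟩ : ∃ r : ℝ, r ∉ (fun l : Fin 2 → ℝ => l 0) '' S := by
    by_contra hcon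
    push Not at hcon
    apply Cardinal.not_countable_real
    exact (hS.image (fun l : Fin 2 → ℝ => l 0)).mono (fun x _ => hcon x)
  set ξ : Fin 2 → ℝ := fun _ => r with hξ
  have hne : ∀ l : S, ξ 0 - (l : Fin 2 → ℝ) 0 ≠ 0 := by
    intro l h
    exact hr ⟨l, l.2, (sub_eq_zero.mp h).symm⟩
  refine dhl (fun l : S => ‖ftMeasure μ (ξ - l)‖ ^ 2) (fun l => by positivity) (hsum ξ)
    (fun n => {l : S | |ξ 0 - (l : Fin 2 → ℝ) 0| < (A : ℝ) ^ (n + 1) / (2 * B * p)}) ?_ ?_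
    (fun n l => ‖Pp (mask (digitR D)) (Rmap ρ₁ ρ₂ c) n (ξ - l)‖ ^ 2) (fun n l => by positivity) ?_ ?_ ?_
    N hNm (fun i => Φ (N i / s) ^ 2) (fun i => by positivity) ?_ ?_ ?_
  · intro n n' h l hl
    rw [Set.mem_setOf_eq] at hl ⊢
    refine lt_of_lt_of_le hl ?_
    have : (A : ℝ) ^ (n + 1) ≤ (A : ℝ) ^ (n' + 1) := pow_le_pow_right₀ (by linarith) (by omega)
    gcongr
  · intro l
    obtain ⟨n, hn⟩ := pow_unbounded_of_one_lt (|ξ 0 - (l : Fin 2 → ℝ) 0| * (2 * B * p)) (show (1 : ℝ) < A by linarith)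
    refine ⟨n, ?_⟩
    rw [Set.mem_setOf_eq, lt_div_iff₀ (by positivity)]
    exact hn.trans_le (pow_le_pow_right₀ (by linarith) (by omega))
  · intro n t ht
    obtain ⟨ν, hν, hνF⟩ := exists_partial hp.ne_zero ρ₁ ρ₂ c h10.ne' h20.ne' (digitR D) (Measure.dirac 0) n
    have hνF2 : ∀ η, ftMeasure ν η = Pp (mask (digitR D)) (Rmap ρ₁ ρ₂ c) n η := by
      intro η; rw [hνF, ft_dirac, mul_one]
    have horth : IsOrthoSet ν {x | x ∈ S ∧ |ξ 0 - x 0| < (A : ℝ) ^ (n + 1) / (2 * B * p)} := by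
      rintro x ⟨hx, hx2⟩ y ⟨hy, hy2⟩ hxy
      obtain ⟨i, hi⟩ := mask_of_ft_zero _ _ _ hF (ft_cont μ) (ft_zero μ)
        (Rmap_iter_tendsto ρ₁ ρ₂ c h10 h11 h20 h21 hρ) _ (ho x hx y hy hxy)
      have h1 := hsep x hx y hy i hi
      have h2 : |x 0 - y 0| ≤ |ξ 0 - x 0| + |ξ 0 - y 0| := by
        rw [show x 0 - y 0 = (ξ 0 - y 0) - (ξ 0 - x 0) by ring, add_comm]
        exact abs_sub _ _
      have h3 : (A : ℝ) ^ (i + 1) / (B * p) < (A : ℝ) ^ (n + 1) / (B * p) := by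
        have : (A : ℝ) ^ (n + 1) / (B * p) = (A : ℝ) ^ (n + 1) / (2 * B * p) + (A : ℝ) ^ (n + 1) / (2 * B * p) := by
          field_simp; ring
        rw [this]; linarith
      have h4 := (div_lt_div_iff_of_pos_right (by positivity)).mp h3
      have h5 := (pow_lt_pow_iff_right₀ (show (1 : ℝ) < A by linarith)).mp h4
      rw [hνF2]
      exact Pp_eq_zero _ _ n i (by omega) _ hi
    have := bessel ν _ horth ξ (t.map (Function.Embedding.subtype _)) (by
      intro x hx
      rw [Finset.mem_coe, Finset.mem_map] at hx
      obtain ⟨l, hl, rfl⟩ := hx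
      exact ⟨l.2, ht l hl⟩)
    rw [Finset.sum_map] at this
    simpa only [hνF2, Function.Embedding.subtype_apply] using this
  · intro n l
    rw [ft_iter _ _ _ hF n (ξ - l), norm_mul]
    have := ft_norm_le μ ((Rmap ρ₁ ρ₂ c)^[n] (ξ - l))
    gcongr
    exact mul_le_of_le_one_right (norm_nonneg _) this
  · intro n l hl
    rw [ft_iter _ _ _ hF n (ξ - l), norm_mul]
    have h1 := F_lt hp ρ₁ ρ₂ c h10 h11 D hD0 hD11 hD10 (ftMeasure μ) (ft_norm_le μ) hF
      ((Rmap ρ₁ ρ₂ c)^[n] (ξ - l)) (by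
        rw [Rmap_iter_zero_coord]
        exact mul_ne_zero (pow_ne_zero _ h10.ne') (hne l))
    have h2 : 0 < ‖Pp (mask (digitR D)) (Rmap ρ₁ ρ₂ c) n (ξ - l)‖ := by
      by_contra h
      have : ‖Pp (mask (digitR D)) (Rmap ρ₁ ρ₂ c) n (ξ - l)‖ = 0 := le_antisymm (not_lt.mp h) (norm_nonneg _)
      rw [this] at hl; simp at hl
    apply pow_lt_pow_left₀ _ (by positivity) two_ne_zero
    exact mul_lt_of_lt_one_right h2 h1
  · intro i; exact pow_le_one₀ (hΦ0 _) (hΦ1 _)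
  · apply summable_J _ (fun i => by positivity) (s * (1 + 4 * s)) (q ^ 2) (pow_lt_one₀ hq0 hq1 two_ne_zero)
    intro i
    rw [← mul_pow]
    apply pow_le_pow_left₀ (hΦ0 _)
    refine le_trans (hΦa ?_) (hdec _ (hNa i))
    refine le_trans ?_ (hNd (1 + 4 * s) i)
    exact Nat.mul_le_mul_right _ (Nat.lt_two_pow_self).le
  · intro i l _ hl
    have hl2 : (A : ℝ) ^ (N i + 1) / (2 * B * p) ≤ |ξ 0 - (l : Fin 2 → ℝ) 0| := not_lt.mp hl
    rw [ft_iter _ _ _ hF (N (i + 1)) (ξ - l), norm_mul, mul_pow, mul_comm]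
    have h1 := hΦ (N i / s) ((Rmap ρ₁ ρ₂ c)^[N (i + 1)] (ξ - l)) (by
      rw [Rmap_iter_zero_coord, abs_mul, abs_of_pos (by positivity), hNr, hρAB]
      have h2 : (B : ℝ) / A ≤ 1 := by rw [div_le_one hA0]; exact hBAr.le
      refine le_trans ?_ (mul_le_mul_of_nonneg_left hl2 (by positivity))
      have h3 : (A : ℝ) ^ (N i / s) ≤ (B : ℝ) ^ (N i) := by
        calc (A : ℝ) ^ (N i / s) ≤ ((B : ℝ) ^ s) ^ (N i / s) := by gcongr
          _ = (B : ℝ) ^ (s * (N i / s)) := by rw [pow_mul]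
          _ ≤ _ := pow_le_pow_right₀ (by linarith) (Nat.mul_div_le _ _)
      generalize N i / s = b at *
      generalize N i = n at *
      rw [div_pow, div_mul_div_comm, div_le_div_iff₀ (by positivity) (by positivity), pow_add, pow_add, pow_succ]
      have h4 : (A : ℝ) ^ b * B ≤ (B : ℝ) ^ n * A := by gcongr
      have h5 := mul_le_mul_of_nonneg_left h4 (show (0 : ℝ) ≤ (B : ℝ) ^ b * A ^ n * (2 * p) by positivity)
      calc _ = (B : ℝ) ^ b * A ^ n * (2 * p) * (A ^ b * B) := by ring
        _ ≤ _ := h5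
        _ = _ := by ring)
    gcongr

lemma stmt6_necessity {p : ℕ} (hp : p.Prime) (ρ₁ ρ₂ c : ℝ)
    (h10 : 0 < ρ₁) (h11 : ρ₁ < 1) (h20 : 0 < ρ₂) (h21 : ρ₂ < 1) (hρ : ρ₁ ≠ ρ₂)
    (D : Fin p → (Fin 2 → ℤ)) (a : Fin 2 → ℤ) (hZ : ZeroSetCond p D a) (hD0 : D ⟨0, hp.pos⟩ = 0)
    (hD11 : D ⟨1, hp.one_lt⟩ 1 = 0) (hD10 : D ⟨1, hp.one_lt⟩ 0 ≠ 0)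
    (μ : Measure (Fin 2 → ℝ)) (hμ : IsSelfAffine μ (Mupper ρ₁ ρ₂ c) (digitR D)) (h : IsSpectral μ) :
    ∃ n : ℤ, (p : ℤ) ∣ n ∧ ρ₁⁻¹ = (n : ℝ) := by
  haveI := hμ.1
  have hF := ft_selfaffine ρ₁ ρ₂ c h10.ne' h20.ne' (digitR D) μ hμ
  obtain ⟨S, hS, ho, hsum⟩ := sum_of_spectral μ h
  obtain ⟨A, B, hB, hcop, hAB, hpA, hsep⟩ := nec_struct hp ρ₁ ρ₂ c h10 h11 h20 h21 hρ D a hZ hD0 hD11 hD10 μ hF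
    S hS ho hsum
  have hB1 : B = 1 := by
    by_contra hne
    exact nec_B hp ρ₁ ρ₂ c h10 h11 h20 h21 hρ D hD0 hD11 hD10 μ hF S hS ho hsum A B (by omega) hcop hAB hsep
  refine ⟨A, Int.natCast_dvd_natCast.mpr hpA, ?_⟩
  rw [hAB, hB1]; simp

/-- Theorem 1.5: with `ρ₁ ≠ ρ₂` and `c'' = c/(ρ₁⁻¹ − ρ₂⁻¹) ∈ ℚ ∖ E_a`, `μ_{M,D}` is a
spectral measure iff `ρ₁⁻¹ ∈ pℤ`. -/
theorem stmt6 (p : ℕ) (hp : p.Prime) (ρ₁ ρ₂ c : ℝ)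
    (hρ10 : 0 < ρ₁) (hρ11 : ρ₁ < 1) (hρ20 : 0 < ρ₂) (hρ21 : ρ₂ < 1) (hρ : ρ₁ ≠ ρ₂)
    (D : Fin p → (Fin 2 → ℤ)) (hD : Function.Injective D)
    (a : Fin 2 → ℤ) (hZ : ZeroSetCond p D a)
    (hD0 : D ⟨0, hp.pos⟩ = 0)
    (hD11 : D ⟨1, hp.one_lt⟩ 1 = 0) (hD10 : D ⟨1, hp.one_lt⟩ 0 ≠ 0)
    (μ : Measure (Fin 2 → ℝ)) (hμ : IsSelfAffine μ (Mupper ρ₁ ρ₂ c) (digitR D))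
    (hrat : ∃ q : ℚ, c / (ρ₁⁻¹ - ρ₂⁻¹) = (q : ℝ))
    (hnE : c / (ρ₁⁻¹ - ρ₂⁻¹) ∉ Ea p a) :
    IsSpectral μ ↔ ∃ n : ℤ, (p : ℤ) ∣ n ∧ ρ₁⁻¹ = (n : ℝ) := by
  constructor
  · exact stmt6_necessity hp ρ₁ ρ₂ c hρ10 hρ11 hρ20 hρ21 hρ D a hZ hD0 hD11 hD10 μ hμ
  · rintro ⟨n, ⟨mm, rfl⟩, hn⟩
    exact sufficiency p hp ρ₁ ρ₂ c hρ10 hρ11 hρ20 hρ21 hρ D a hZ μ hμ hrat hnE mm hn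

end
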